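/- arXiv:2102.10217 — 2 statements merged into one kernel-verified Lean document; each statement's English description precedes it below -/
import Mathlib

section
/- Lemma 3.5, part 3 (two-sided bound on the Hessian quadratic form). There exist universal constants c, C > 0 such that the following holds. Let σ⁺ ≥ σ⁻ > 0, κ := σ⁺/σ⁻, μ ≥ 1 and r ≤ q. Let b̂_k ∈ ℝ^r for k ∈ [q] and let B̂ be the r×q matrix with columns b̂_k. Assume (all deterministic): max_k ‖b̂_k‖ ≤ 1.1·μσ⁺√(r/q); σ_r(B̂) ≥ 0.9·σ⁻; and ‖B̂‖ ≤ 1.04·σ⁺. Let a_ki (k ∈ [q], i ∈ [m]) be i.i.d. standard Gaussian random vectors in ℝⁿ. Then for every ε₃ ∈ (0,1), with probability at least 1 − exp(C·nr·(1 + log κ) − c·mq·ε₃²/(r·κ⁴·μ²)), the following holds simultaneously for all n×r real matrices W with ‖W‖_F = 1: m·(0.65 − 1.2ε₃)·σ⁻² ≤ Σ_{k,i}(a_kiᵀWb̂_k)² ≤ m·(1.1 + ε₃)·σ⁺². -/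
open MeasureTheory ProbabilityTheory Matrix
open scoped ENNReal

noncomputable section

/-- Euclidean norm of a finitely-indexed real vector. -/
def vnorm {ι : Type*} [Fintype ι] (v : ι → ℝ) : ℝ := Real.sqrt (∑ i, v i ^ 2)

/-- Frobenius norm of a real matrix. -/
def frob {ι ι' : Type*} [Fintype ι] [Fintype ι'] (M : Matrix ι ι' ℝ) : ℝ :=
  Real.sqrt (∑ i, ∑ j, M i j ^ 2)

/-- Spectral (ℓ2 operator) norm of a real matrix. -/
def spec {ι ι' : Type*} [Fintype ι] [Fintype ι'] (M : Matrix ι ι' ℝ) : ℝ :=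
  sSup {c | ∃ z, vnorm z = 1 ∧ c = vnorm (M.mulVec z)}

/-- Smallest singular value of an r×q matrix with r ≤ q (or of a square matrix):
the minimum of ‖Bᵀw‖ over unit vectors w. -/
def sigMin {ι ι' : Type*} [Fintype ι] [Fintype ι'] (B : Matrix ι ι' ℝ) : ℝ :=
  sInf {c | ∃ w, vnorm w = 1 ∧ c = vnorm (Bᵀ.mulVec w)}

/-- The k-th column of a matrix. -/
def matCol {ι ι' : Type*} (B : Matrix ι ι' ℝ) (k : ι') : ι → ℝ := fun i => B i k

/-- Subspace distance SD(U₁,U₂) := ‖(I − U₁U₁ᵀ)U₂‖_F. -/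
def SD {n r : ℕ} (U₁ U₂ : Matrix (Fin n) (Fin r) ℝ) : ℝ :=
  frob ((1 - U₁ * U₁ᵀ) * U₂)

/-- The standard Gaussian measure on ℝ. -/
def stdGaussian : Measure ℝ := gaussianReal 0 1

instance : IsProbabilityMeasure stdGaussian :=
  inferInstanceAs (IsProbabilityMeasure (gaussianReal 0 1))

/-- A standard Gaussian random vector in ℝⁿ (i.i.d. N(0,1) coordinates). -/
def gaussianVec (n : ℕ) : Measure (Fin n → ℝ) := Measure.pi fun _ => stdGaussian

instance (n : ℕ) : IsProbabilityMeasure (gaussianVec n) := by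
  unfold gaussianVec; infer_instance

/-- i.i.d. standard Gaussian random vectors a_{k i} ∈ ℝⁿ, k ∈ [q], i ∈ [m]. -/
def gaussianMatrices (q m n : ℕ) : Measure (Fin q → Fin m → Fin n → ℝ) :=
  Measure.pi fun _ => Measure.pi fun _ => gaussianVec n

instance (q m n : ℕ) : IsProbabilityMeasure (gaussianMatrices q m n) := by
  unfold gaussianMatrices; infer_instance

/-- Truncated spectral-initialization matrix X̂₀ = (1/m) Σ_{k,i} a_ki y_ki 1{y_ki² ≤ α} e_kᵀ. -/
def initMat {n q m : ℕ} (xstar : Fin q → Fin n → ℝ) (α : ℝ)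
    (ω : Fin q → Fin m → Fin n → ℝ) : Matrix (Fin n) (Fin q) ℝ :=
  Matrix.of fun j k => (1 / (m : ℝ)) * ∑ i, ω k i j * (ω k i ⬝ᵥ xstar k) *
    (if (ω k i ⬝ᵥ xstar k) ^ 2 ≤ α then 1 else 0)

/-- Data-dependent truncation threshold α := C̃ Σ_{k,i} y_ki² / (mq). -/
def initAlpha {n q m : ℕ} (xstar : Fin q → Fin n → ℝ) (Ctil : ℝ)
    (ω : Fin q → Fin m → Fin n → ℝ) : ℝ :=
  Ctil * ((∑ k, ∑ i, (ω k i ⬝ᵥ xstar k) ^ 2) / ((m : ℝ) * q))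

/-- β(α) := E[ζ² 1{‖x‖² ζ² ≤ α}] for ζ standard Gaussian. -/
def betaK (normx α : ℝ) : ℝ :=
  ∫ z, z ^ 2 * (if normx ^ 2 * z ^ 2 ≤ α then 1 else 0) ∂stdGaussian

/-- The least-squares estimate b̂ := (UᵀAᵀAU)⁻¹ Uᵀ Aᵀ A x. -/
def lsEst {n r m : ℕ} (U : Matrix (Fin n) (Fin r) ℝ) (A : Matrix (Fin m) (Fin n) ℝ)
    (x : Fin n → ℝ) : Fin r → ℝ :=
  ((Uᵀ * Aᵀ * A * U)⁻¹ * Uᵀ * Aᵀ * A).mulVec x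

/-- Gradient w.r.t. U of the squared loss: Σ_k Aᵀ(AUb̂_k − Ax*_k)b̂_kᵀ. -/
def gradU {n r q m : ℕ} (U : Matrix (Fin n) (Fin r) ℝ)
    (A : Fin q → Matrix (Fin m) (Fin n) ℝ) (xstar : Fin q → Fin n → ℝ)
    (bhat : Fin q → Fin r → ℝ) : Matrix (Fin n) (Fin r) ℝ :=
  ∑ k, (A k)ᵀ * vecMulVec ((A k).mulVec (U.mulVec (bhat k) - xstar k)) (bhat k)

/-- `U` has orthonormal columns whose span is the span of eigenvectors of `S`
corresponding to its `r` largest eigenvalues: `S` maps the column span of `U` into itself,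
and wᵀSw ≥ zᵀSz for unit w in the span and unit z orthogonal to it. -/
def IsTopREigenBasis {n r : ℕ} (S : Matrix (Fin n) (Fin n) ℝ)
    (U : Matrix (Fin n) (Fin r) ℝ) : Prop :=
  Uᵀ * U = 1 ∧ (∃ M : Matrix (Fin r) (Fin r) ℝ, S * U = U * M) ∧
  ∀ w z : Fin n → ℝ, (∃ cvec : Fin r → ℝ, w = U.mulVec cvec) → Uᵀ.mulVec z = 0 →
    vnorm w = 1 → vnorm z = 1 → z ⬝ᵥ S.mulVec z ≤ w ⬝ᵥ S.mulVec w

/-- Sample sizes for the 2T+1 sample splits: batch τ ∈ {0,…,T} has m τ rows,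
batch τ = T + t (t ∈ {1,…,T}) has m t rows. -/
def msize (m : ℕ → ℕ) (T τ : ℕ) : ℕ := if τ ≤ T then m τ else m (τ - T)

/-- The joint distribution of all 2T+1 independent sample batches of i.i.d. standard
Gaussian measurement vectors. -/
def splitGauss (m : ℕ → ℕ) (T q n : ℕ) :
    Measure (∀ τ : Fin (2 * T + 1), Fin q → Fin (msize m T τ.1) → Fin n → ℝ) :=
  Measure.pi fun τ => gaussianMatrices q (msize m T τ.1) n

instance (m : ℕ → ℕ) (T q n : ℕ) : IsProbabilityMeasure (splitGauss m T q n) := by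
  unfold splitGauss; infer_instance

end

lemma inv_sqrt_one_sub_two_mul_le_exp {s : ℝ} (hs : |s| ≤ 1 / 4) :
    (Real.sqrt (1 - 2 * s))⁻¹ ≤ Real.exp (s + 4 * s ^ 2) := by
  obtain ⟨h1, h2⟩ := abs_le.mp hs
  have hpos : 0 < 1 - 2 * s := by linarith
  have habs : |2 * s| = 2 * |s| := by rw [abs_mul, abs_two]
  have hlog := Real.abs_log_sub_add_sum_range_le (x := 2 * s) (by rw [habs]; linarith) 1
  simp only [Finset.sum_range_one, zero_add, pow_one, Nat.cast_zero, div_one] at hlog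
  have hquad : |2 * s| ^ (1 + 1) / (1 - |2 * s|) ≤ 8 * s ^ 2 := by
    rw [div_le_iff₀ (by rw [habs]; linarith), habs]
    have : (2 * |s|) ^ (1 + 1) = 4 * s ^ 2 := by
      rw [mul_pow, ← sq_abs s]; norm_num
    rw [this]
    nlinarith [sq_nonneg s]
  have hlow := (abs_le.mp (hlog.trans hquad)).1
  rw [← Real.exp_log (inv_pos.mpr (Real.sqrt_pos.mpr hpos)), Real.exp_le_exp,
    Real.log_inv, Real.log_sqrt hpos.le]
  linarith

lemma gaussianPDFReal_smul_exp (s x : ℝ) :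
    gaussianPDFReal 0 1 x • Real.exp (s * (x ^ 2 - 1)) =
      ((Real.sqrt (2 * Real.pi))⁻¹ * Real.exp (-s)) * Real.exp (-(1 / 2 - s) * x ^ 2) := by
  rw [gaussianPDFReal_def, smul_eq_mul, mul_assoc, ← Real.exp_add, mul_assoc _ (Real.exp (-s)),
    ← Real.exp_add]
  simp only [NNReal.coe_one, mul_one, sub_zero]
  ring_nf

/-- The centered square of a standard Gaussian variable has a finite exponential moment. -/
lemma integrable_exp_sq_sub_one_gaussianReal {s : ℝ} (hs : s < 1 / 2) :
    Integrable (fun x : ℝ => Real.exp (s * (x ^ 2 - 1))) (gaussianReal 0 1) := by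
  rw [gaussianReal_of_var_ne_zero _ one_ne_zero,
    integrable_withDensity_iff_integrable_smul' (measurable_gaussianPDF _ _)
      (ae_of_all _ fun _ => gaussianPDF_lt_top)]
  simp only [toReal_gaussianPDF, gaussianPDFReal_smul_exp]
  exact (integrable_exp_neg_mul_sq (by linarith)).const_mul _

/-- The centered square of a standard Gaussian variable is sub-exponential. -/
lemma integral_exp_sq_sub_one_gaussianReal_le {s : ℝ} (hs : |s| ≤ 1 / 4) :
    ∫ x : ℝ, Real.exp (s * (x ^ 2 - 1)) ∂gaussianReal 0 1 ≤ Real.exp (4 * s ^ 2) := by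
  have hpos : 0 < 1 - 2 * s := by linarith [(abs_le.mp hs).2]
  rw [integral_gaussianReal_eq_integral_smul one_ne_zero]
  simp only [gaussianPDFReal_smul_exp]
  rw [integral_const_mul, integral_gaussian]
  have hsqrt : Real.sqrt (Real.pi / (1 / 2 - s)) =
      Real.sqrt (2 * Real.pi) * (Real.sqrt (1 - 2 * s))⁻¹ := by
    rw [← Real.sqrt_inv, ← Real.sqrt_mul (by positivity)]
    congr 1
    have : 1 / 2 - s ≠ 0 := by linarith
    field_simp
  have h2pi : Real.sqrt (2 * Real.pi) ≠ 0 := by positivity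
  calc _ = Real.exp (-s) * (Real.sqrt (1 - 2 * s))⁻¹ := by rw [hsqrt]; field_simp
    _ ≤ Real.exp (-s) * Real.exp (s + 4 * s ^ 2) := by
        gcongr; exact inv_sqrt_one_sub_two_mul_le_exp hs
    _ = Real.exp (4 * s ^ 2) := by rw [← Real.exp_add]; ring_nf

/-- A linear functional of a standard Gaussian vector has the law of a scaled standard Gaussian
variable. -/
lemma map_dotProduct_gaussianVec {n : ℕ} (v : Fin n → ℝ) :
    (gaussianVec n).map (fun a => a ⬝ᵥ v) = (gaussianReal 0 1).map (vnorm v * ·) := by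
  have hm : Measurable fun a : Fin n → ℝ => a ⬝ᵥ v := by unfold dotProduct; fun_prop
  have hv : vnorm v ^ 2 = ∑ i, v i ^ 2 := Real.sq_sqrt (Finset.sum_nonneg fun i _ => sq_nonneg _)
  refine Measure.ext_of_charFun ?_
  ext t
  rw [gaussianReal_map_const_mul, charFun_gaussianReal, charFun_apply_real,
    integral_map hm.aemeasurable (by fun_prop)]
  have hexp (a : Fin n → ℝ) : Complex.exp (t * (a ⬝ᵥ v : ℝ) * Complex.I) =
      ∏ i, Complex.exp ((v i * t : ℝ) * a i * Complex.I) := by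
    rw [← Complex.exp_sum]
    congr 1
    simp only [dotProduct]
    push_cast
    rw [Finset.mul_sum, Finset.sum_mul]
    exact Finset.sum_congr rfl fun i _ => by ring
  simp only [hexp, gaussianVec]
  rw [integral_fintype_prod_eq_prod (𝕜 := ℂ)
    (fun i x => Complex.exp ((v i * t : ℝ) * (x : ℝ) * Complex.I))]
  simp only [_root_.stdGaussian, ← charFun_apply_real, charFun_gaussianReal]
  rw [← Complex.exp_sum]
  congr 1
  simp only [NNReal.coe_mk, NNReal.coe_mul, hv]
  push_cast
  simp [Finset.sum_div, Finset.sum_mul, mul_pow]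

lemma integrable_exp_sq_dotProduct_gaussianVec {n : ℕ} (v : Fin n → ℝ) {s : ℝ}
    (hs : |s| * vnorm v ^ 2 ≤ 1 / 4) :
    Integrable (fun a => Real.exp (s * ((a ⬝ᵥ v) ^ 2 - vnorm v ^ 2))) (gaussianVec n) := by
  have hm : Measurable fun a : Fin n → ℝ => a ⬝ᵥ v := by unfold dotProduct; fun_prop
  have hlt : s * vnorm v ^ 2 < 1 / 2 := by
    nlinarith [mul_le_mul_of_nonneg_right (le_abs_self s) (sq_nonneg (vnorm v))]
  have h := integrable_exp_sq_sub_one_gaussianReal hlt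
  have h' : Integrable (fun y => Real.exp (s * (y ^ 2 - vnorm v ^ 2)))
      ((gaussianVec n).map fun a => a ⬝ᵥ v) := by
    rw [map_dotProduct_gaussianVec, integrable_map_measure (by fun_prop) (by fun_prop)]
    refine h.congr (ae_of_all _ fun x => ?_)
    simp only [Function.comp_apply]
    ring_nf
  exact h'.comp_measurable hm

lemma integral_exp_sq_dotProduct_gaussianVec_le {n : ℕ} (v : Fin n → ℝ) {s : ℝ}
    (hs : |s| * vnorm v ^ 2 ≤ 1 / 4) :
    ∫ a, Real.exp (s * ((a ⬝ᵥ v) ^ 2 - vnorm v ^ 2)) ∂gaussianVec n ≤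
      Real.exp (4 * s ^ 2 * vnorm v ^ 4) := by
  have hm : Measurable fun a : Fin n → ℝ => a ⬝ᵥ v := by unfold dotProduct; fun_prop
  have habs : |s * vnorm v ^ 2| ≤ 1 / 4 := by
    rwa [abs_mul, abs_of_nonneg (sq_nonneg (vnorm v))]
  have h := integral_exp_sq_sub_one_gaussianReal_le habs
  rw [← integral_map (φ := fun a : Fin n → ℝ => a ⬝ᵥ v)
    (f := fun y => Real.exp (s * (y ^ 2 - vnorm v ^ 2))) hm.aemeasurable (by fun_prop),
    map_dotProduct_gaussianVec, integral_map (by fun_prop) (by fun_prop)]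
  calc _ = ∫ x : ℝ, Real.exp (s * vnorm v ^ 2 * (x ^ 2 - 1)) ∂gaussianReal 0 1 := by
        congr 1; ext x; ring_nf
    _ ≤ _ := h.trans_eq (by ring_nf)

section ChiSquare

variable {n q m : ℕ} (v : Fin q → Fin n → ℝ)

/-- The centered sum of squares `Σ_{k,i} ((a_kiᵀ v_k)² − ‖v_k‖²)`. -/
noncomputable def centeredSumSq (ω : Fin q → Fin m → Fin n → ℝ) : ℝ :=
  ∑ k, ∑ i, ((ω k i ⬝ᵥ v k) ^ 2 - vnorm (v k) ^ 2)

lemma exp_mul_centeredSumSq (s : ℝ) (ω : Fin q → Fin m → Fin n → ℝ) :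
    Real.exp (s * centeredSumSq v ω) =
      ∏ k, ∏ i, Real.exp (s * ((ω k i ⬝ᵥ v k) ^ 2 - vnorm (v k) ^ 2)) := by
  simp only [← Real.exp_sum, centeredSumSq, Finset.mul_sum]

variable {v} {K V s : ℝ}

lemma integrable_exp_mul_centeredSumSq (hs : ∀ k, |s| * vnorm (v k) ^ 2 ≤ 1 / 4) :
    Integrable (fun ω => Real.exp (s * centeredSumSq v ω)) (gaussianMatrices q m n) := by
  simp only [exp_mul_centeredSumSq]
  exact Integrable.fintype_prod
    (f := fun k (x : Fin m → Fin n → ℝ) =>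
      ∏ i, Real.exp (s * ((x i ⬝ᵥ v k) ^ 2 - vnorm (v k) ^ 2)))
    fun k => Integrable.fintype_prod
      (f := fun _ (a : Fin n → ℝ) => Real.exp (s * ((a ⬝ᵥ v k) ^ 2 - vnorm (v k) ^ 2)))
      fun _ => integrable_exp_sq_dotProduct_gaussianVec (v k) (hs k)

lemma mgf_centeredSumSq_le (hs : ∀ k, |s| * vnorm (v k) ^ 2 ≤ 1 / 4)
    (hV : ∑ k, vnorm (v k) ^ 4 ≤ V) :
    mgf (centeredSumSq v) (gaussianMatrices q m n) s ≤ Real.exp (4 * s ^ 2 * (m * V)) := by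
  simp only [mgf, exp_mul_centeredSumSq, gaussianMatrices]
  rw [integral_fintype_prod_eq_prod (𝕜 := ℝ)
    (fun k (x : Fin m → Fin n → ℝ) =>
      ∏ i, Real.exp (s * ((x i ⬝ᵥ v k) ^ 2 - vnorm (v k) ^ 2)))]
  have hk (k : Fin q) : ∫ x : Fin m → Fin n → ℝ,
      ∏ i, Real.exp (s * ((x i ⬝ᵥ v k) ^ 2 - vnorm (v k) ^ 2))
        ∂Measure.pi (fun _ => gaussianVec n) ≤ Real.exp (m * (4 * s ^ 2 * vnorm (v k) ^ 4)) := by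
    rw [integral_fintype_prod_eq_prod (𝕜 := ℝ)
      (fun _ (a : Fin n → ℝ) => Real.exp (s * ((a ⬝ᵥ v k) ^ 2 - vnorm (v k) ^ 2))),
      Finset.prod_const, Finset.card_univ, Fintype.card_fin, Real.exp_nat_mul]
    exact pow_le_pow_left₀ (integral_nonneg fun _ => (Real.exp_pos _).le)
      (integral_exp_sq_dotProduct_gaussianVec_le (v k) (hs k)) m
  refine (Finset.prod_le_prod (fun k _ => integral_nonneg fun x =>
    Finset.prod_nonneg fun i _ => (Real.exp_pos _).le) fun k _ => hk k).trans ?_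
  rw [← Real.exp_sum, Real.exp_le_exp, ← Finset.mul_sum, ← Finset.mul_sum]
  calc (m : ℝ) * (4 * s ^ 2 * ∑ k, vnorm (v k) ^ 4) = 4 * s ^ 2 * (m * ∑ k, vnorm (v k) ^ 4) := by
        ring
    _ ≤ _ := by gcongr

/-- Two-sided Bernstein-type tail bound for a weighted sum of independent centered chi-squares,
in the sub-Gaussian range `t * K ≤ 2 * V`. -/
lemma measureReal_le_abs_centeredSumSq {t : ℝ} (ht : 0 ≤ t) (hV0 : 0 < V)
    (hK : ∀ k, vnorm (v k) ^ 2 ≤ K) (hV : ∑ k, vnorm (v k) ^ 4 ≤ V) (htK : t * K ≤ 2 * V) :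
    (gaussianMatrices q m n).real {ω | m * t ≤ |centeredSumSq v ω|} ≤
      2 * Real.exp (-(m * t ^ 2 / (16 * V))) := by
  set s := t / (8 * V) with hsdef
  have hs0 : 0 ≤ s := by positivity
  have hs (k : Fin q) : |s| * vnorm (v k) ^ 2 ≤ 1 / 4 := by
    rw [abs_of_nonneg hs0]
    calc s * vnorm (v k) ^ 2 ≤ s * K := by gcongr; exact hK k
      _ = t * K / (8 * V) := by rw [hsdef]; ring
      _ ≤ 1 / 4 := by rw [div_le_iff₀ (by positivity)]; linarith
  have hs' (k : Fin q) : |-s| * vnorm (v k) ^ 2 ≤ 1 / 4 := by rw [abs_neg]; exact hs k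
  have hexp : -s * (m * t) + 4 * s ^ 2 * (m * V) = -(m * t ^ 2 / (16 * V)) := by
    rw [hsdef]; field_simp; ring
  have hup := measure_ge_le_exp_mul_mgf (μ := gaussianMatrices q m n) (X := centeredSumSq v)
    (m * t) hs0 (integrable_exp_mul_centeredSumSq hs)
  have hlo := measure_le_le_exp_mul_mgf (μ := gaussianMatrices q m n) (X := centeredSumSq v)
    (-(m * t)) (neg_nonpos.mpr hs0) (integrable_exp_mul_centeredSumSq hs')
  have hup' := hup.trans (mul_le_mul_of_nonneg_left (mgf_centeredSumSq_le hs hV)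
    (Real.exp_pos _).le)
  have hlo' := hlo.trans (mul_le_mul_of_nonneg_left (mgf_centeredSumSq_le hs' hV)
    (Real.exp_pos _).le)
  rw [← Real.exp_add] at hup' hlo'
  rw [hexp] at hup'
  rw [neg_sq, show - -s * -(m * t) = -s * (m * t) by ring, hexp] at hlo'
  have hset : {ω : Fin q → Fin m → Fin n → ℝ | m * t ≤ |centeredSumSq v ω|} =
      {ω | m * t ≤ centeredSumSq v ω} ∪ {ω | centeredSumSq v ω ≤ -(m * t)} := by
    ext ω
    simp only [Set.mem_ofPred_eq, Set.mem_union, le_abs, le_neg]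
  rw [hset, two_mul]
  exact (measureReal_union_le _ _).trans (add_le_add hup' hlo')

end ChiSquare

/-- The unit sphere of a `d`-dimensional space has a `1/2`-net with at most `5 ^ d` points. -/
lemma exists_half_net_sphere (E : Type*) [NormedAddCommGroup E] [NormedSpace ℝ E]
    [FiniteDimensional ℝ E] :
    ∃ s : Finset E, s.card ≤ 5 ^ Module.finrank ℝ E ∧ (∀ y ∈ s, ‖y‖ = 1) ∧
      ∀ x : E, ‖x‖ = 1 → ∃ y ∈ s, ‖x - y‖ ≤ 1 / 2 := by
  classical
  let P : Finset E → Prop := fun s =>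
    (∀ y ∈ s, ‖y‖ = 1) ∧ ∀ c ∈ s, ∀ d ∈ s, c ≠ d → 1 / 2 ≤ ‖c - d‖
  have hcard (s : Finset E) (hs : P s) : s.card ≤ 5 ^ Module.finrank ℝ E := by
    have hinj : Function.Injective fun x : E => (2 : ℝ) • x :=
      smul_right_injective E two_ne_zero
    rw [← Finset.card_image_of_injective s hinj]
    refine Besicovitch.card_le_of_separated _ ?_ ?_
    · intro c hc
      obtain ⟨y, hy, rfl⟩ := Finset.mem_image.mp hc
      simp [norm_smul, hs.1 y hy]
    · intro c hc d hd hcd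
      obtain ⟨y, hy, rfl⟩ := Finset.mem_image.mp hc
      obtain ⟨z, hz, rfl⟩ := Finset.mem_image.mp hd
      have := hs.2 y hy z hz fun h => hcd (by rw [h])
      rw [← smul_sub, norm_smul, Real.norm_two]
      linarith
  let A : Set ℕ := {N | ∃ s, P s ∧ s.card = N}
  have hbdd : BddAbove A := by
    refine ⟨5 ^ Module.finrank ℝ E, ?_⟩
    rintro N ⟨s, hs, rfl⟩
    exact hcard s hs
  have hne : A.Nonempty := ⟨0, ∅, ⟨by simp, by simp⟩, rfl⟩
  obtain ⟨s, hs, hmax⟩ := Nat.sSup_mem hne hbdd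
  refine ⟨s, hcard s hs, hs.1, fun x hx => ?_⟩
  by_contra! hfar
  have hxs : x ∉ s := fun h => by
    have := hfar x h
    simp at this
    linarith
  have hP : P (insert x s) := by
    refine ⟨fun y hy => ?_, fun c hc d hd hcd => ?_⟩
    · rcases Finset.mem_insert.mp hy with rfl | hy
      exacts [hx, hs.1 y hy]
    · rcases Finset.mem_insert.mp hc with rfl | hc' <;>
        rcases Finset.mem_insert.mp hd with rfl | hd'
      · exact absurd rfl hcd
      · exact (hfar d hd').le
      · rw [norm_sub_rev]; exact (hfar c hc').le
      · exact hs.2 c hc' d hd' hcd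
  have hle := le_csSup hbdd ⟨insert x s, hP, rfl⟩
  rw [Finset.card_insert_of_notMem hxs, ← hmax] at hle
  omega

/-- A quadratic form bounded by `t` on a `1/2`-net of the unit sphere is bounded by `32 * t` on
the whole sphere. -/
lemma abs_quadraticForm_le_of_net {E : Type*} [NormedAddCommGroup E] [InnerProductSpace ℝ E]
    [FiniteDimensional ℝ E] (Q : QuadraticForm ℝ E) (hQ : Continuous Q) {s : Finset E} {t : ℝ}
    (hs1 : ∀ y ∈ s, ‖y‖ = 1) (hs : ∀ x : E, ‖x‖ = 1 → ∃ y ∈ s, ‖x - y‖ ≤ 1 / 2)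
    (ht : ∀ y ∈ s, |Q y| ≤ t) (x : E) (hx : ‖x‖ = 1) : |Q x| ≤ 32 * t := by
  obtain ⟨x₀, hx₀, hmax⟩ := (isCompact_sphere (0 : E) 1).exists_isMaxOn
    ⟨x, by simpa using hx⟩ hQ.abs.continuousOn
  have hx₀ : ‖x₀‖ = 1 := by simpa using hx₀
  have hM (z : E) : |Q z| ≤ |Q x₀| * ‖z‖ ^ 2 := by
    rcases eq_or_ne z 0 with rfl | hz
    · simp
    have hz' : ‖z‖ ≠ 0 := norm_ne_zero_iff.mpr hz
    have h1 : |Q (‖z‖⁻¹ • z)| ≤ |Q x₀| :=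
      hmax (show ‖z‖⁻¹ • z ∈ Metric.sphere (0 : E) 1 by simp [norm_smul, hz'])
    have h2 : Q z = ‖z‖ ^ 2 * Q (‖z‖⁻¹ • z) := by
      rw [QuadraticMap.map_smul, smul_eq_mul]; field_simp
    rw [h2, abs_mul, abs_of_nonneg (sq_nonneg ‖z‖), mul_comm]
    gcongr
  obtain ⟨y, hy, hxy⟩ := hs x₀ hx₀
  have hpol (a b : ℝ) : Q (a • x₀ + b • y) =
      a ^ 2 * Q x₀ + b ^ 2 * Q y + a * b * QuadraticMap.polar Q x₀ y := by
    rw [QuadraticMap.map_add Q, QuadraticMap.map_smul, QuadraticMap.map_smul,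
      QuadraticMap.polar_smul_left, QuadraticMap.polar_smul_right]
    simp only [smul_eq_mul]
    ring
  have hnorm (a b : ℝ) : ‖a • x₀ + b • y‖ ^ 2 = a ^ 2 + b ^ 2 + 2 * a * b * inner ℝ x₀ y := by
    rw [norm_add_sq_real, norm_smul, norm_smul, hx₀, hs1 y hy, real_inner_smul_left,
      real_inner_smul_right]
    simp only [mul_one, Real.norm_eq_abs, sq_abs]
    ring
  have hinner : 7 / 8 ≤ inner ℝ x₀ y := by
    have h1 := norm_sub_sq_real x₀ y
    rw [hx₀, hs1 y hy] at h1
    nlinarith [norm_nonneg (x₀ - y)]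
  have hp := hM ((5 / 2 : ℝ) • x₀ + (-3 / 2 : ℝ) • y)
  have hm := hM ((-3 / 2 : ℝ) • x₀ + (5 / 2 : ℝ) • y)
  rw [hpol, hnorm] at hp hm
  have hM0 := abs_nonneg (Q x₀)
  have hprod := mul_le_mul_of_nonneg_left hinner hM0
  have hQy := abs_le.mp (ht y hy)
  rw [abs_le] at hp hm
  have hbound : |Q x₀| ≤ t + 31 / 32 * |Q x₀| := by
    refine abs_le.mpr ⟨?_, ?_⟩ <;> linarith [hp.1, hp.2, hm.1, hm.2, hQy.1, hQy.2]
  have hx_le : |Q x| ≤ |Q x₀| := hmax (by simpa using hx)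
  linarith

section Norms

variable {ι ι' : Type*} [Fintype ι] [Fintype ι']

lemma vnorm_nonneg (v : ι → ℝ) : 0 ≤ vnorm v := Real.sqrt_nonneg _

lemma vnorm_sq (v : ι → ℝ) : vnorm v ^ 2 = ∑ i, v i ^ 2 :=
  Real.sq_sqrt (Finset.sum_nonneg fun _ _ => sq_nonneg _)

lemma frob_sq (M : Matrix ι ι' ℝ) : frob M ^ 2 = ∑ i, vnorm (M i) ^ 2 := by
  simp only [vnorm_sq]
  exact Real.sq_sqrt (Finset.sum_nonneg fun _ _ => Finset.sum_nonneg fun _ _ => sq_nonneg _)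

lemma frob_nonneg (M : Matrix ι ι' ℝ) : 0 ≤ frob M := Real.sqrt_nonneg _

lemma vnorm_smul (a : ℝ) (v : ι → ℝ) : vnorm (a • v) = |a| * vnorm v := by
  simp only [vnorm, Pi.smul_apply, smul_eq_mul, mul_pow, ← Finset.mul_sum]
  rw [Real.sqrt_mul (sq_nonneg a), Real.sqrt_sq_eq_abs]

lemma eq_zero_of_vnorm_eq_zero {v : ι → ℝ} (h : vnorm v = 0) : v = 0 := by
  have h2 := vnorm_sq v
  rw [h, zero_pow two_ne_zero, eq_comm,
    Finset.sum_eq_zero_iff_of_nonneg fun _ _ => sq_nonneg _] at h2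
  ext i
  simpa using h2 i (Finset.mem_univ i)

lemma dotProduct_sq_le (v w : ι → ℝ) : (v ⬝ᵥ w) ^ 2 ≤ vnorm v ^ 2 * vnorm w ^ 2 := by
  rw [vnorm_sq, vnorm_sq]
  exact Finset.sum_mul_sq_le_sq_mul_sq _ _ _

lemma vnorm_mulVec_le_frob (M : Matrix ι ι' ℝ) (z : ι' → ℝ) :
    vnorm (M.mulVec z) ≤ frob M * vnorm z := by
  refine le_of_sq_le_sq ?_ (mul_nonneg (frob_nonneg M) (vnorm_nonneg z))
  rw [vnorm_sq, mul_pow, frob_sq, Finset.sum_mul]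
  exact Finset.sum_le_sum fun i _ => dotProduct_sq_le _ _

lemma exists_unit_smul {w : ι → ℝ} (hw : w ≠ 0) :
    ∃ u : ι → ℝ, vnorm u = 1 ∧ w = vnorm w • u := by
  have h : vnorm w ≠ 0 := fun h => hw (eq_zero_of_vnorm_eq_zero h)
  refine ⟨(vnorm w)⁻¹ • w, ?_, ?_⟩
  · rw [vnorm_smul, abs_of_nonneg (inv_nonneg.mpr (vnorm_nonneg w)), inv_mul_cancel₀ h]
  · rw [smul_smul, mul_inv_cancel₀ h, one_smul]

lemma vnorm_zero : vnorm (0 : ι → ℝ) = 0 := by simp [vnorm]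

lemma vnorm_mulVec_le_spec (M : Matrix ι ι' ℝ) (z : ι' → ℝ) :
    vnorm (M.mulVec z) ≤ spec M * vnorm z := by
  rcases eq_or_ne z 0 with rfl | hz
  · simp [vnorm_zero]
  obtain ⟨u, hu, hzu⟩ := exists_unit_smul hz
  have hbdd : BddAbove {c | ∃ z, vnorm z = 1 ∧ c = vnorm (M.mulVec z)} := by
    refine ⟨frob M, ?_⟩
    rintro c ⟨z, hz, rfl⟩
    simpa [hz] using vnorm_mulVec_le_frob M z
  have hle : vnorm (M.mulVec u) ≤ spec M := le_csSup hbdd ⟨u, hu, rfl⟩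
  rw [hzu, mulVec_smul, vnorm_smul, vnorm_smul, hu, mul_one, mul_comm]
  exact mul_le_mul_of_nonneg_right hle (abs_nonneg _)

lemma vnorm_transpose_mulVec_le_spec (M : Matrix ι ι' ℝ) (w : ι → ℝ) :
    vnorm (Mᵀ.mulVec w) ≤ spec M * vnorm w := by
  set z := Mᵀ.mulVec w with hz
  rcases eq_or_ne z 0 with h0 | h0
  · rw [h0, vnorm_zero]
    refine mul_nonneg (Real.sSup_nonneg ?_) (vnorm_nonneg w)
    rintro c ⟨z, -, rfl⟩
    exact vnorm_nonneg _
  have hpos : 0 < vnorm z :=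
    (vnorm_nonneg z).lt_of_ne' fun h => h0 (eq_zero_of_vnorm_eq_zero h)
  have hdot : vnorm z ^ 2 = w ⬝ᵥ M.mulVec z := by
    rw [dotProduct_mulVec, ← mulVec_transpose, ← hz, vnorm_sq]
    simp only [dotProduct, sq]
  have hle : vnorm z ^ 2 ≤ vnorm w * vnorm (M.mulVec z) := by
    rw [hdot]
    refine le_of_sq_le_sq ?_ (mul_nonneg (vnorm_nonneg _) (vnorm_nonneg _))
    rw [mul_pow]
    exact dotProduct_sq_le _ _
  have h2 := mul_le_mul_of_nonneg_left (vnorm_mulVec_le_spec M z) (vnorm_nonneg w)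
  refine le_of_mul_le_mul_right ?_ hpos
  nlinarith

lemma sigMin_mul_vnorm_le (M : Matrix ι ι' ℝ) (w : ι → ℝ) :
    sigMin M * vnorm w ≤ vnorm (Mᵀ.mulVec w) := by
  rcases eq_or_ne w 0 with rfl | hw
  · simp [vnorm_zero]
  obtain ⟨u, hu, hwu⟩ := exists_unit_smul hw
  have hbdd : BddBelow {c | ∃ w, vnorm w = 1 ∧ c = vnorm (Mᵀ.mulVec w)} := by
    refine ⟨0, ?_⟩
    rintro c ⟨w, -, rfl⟩
    exact vnorm_nonneg _
  have hle : sigMin M ≤ vnorm (Mᵀ.mulVec u) := csInf_le hbdd ⟨u, hu, rfl⟩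
  rw [hwu, mulVec_smul, vnorm_smul, vnorm_smul, hu, mul_one, mul_comm]
  exact mul_le_mul_of_nonneg_left hle (abs_nonneg _)

end Norms

section Columns

variable {n r q : ℕ} (W : Matrix (Fin n) (Fin r) ℝ) (b : Fin q → Fin r → ℝ)

lemma sum_vnorm_mulVec_sq : ∑ k, vnorm (W.mulVec (b k)) ^ 2 =
    ∑ j, vnorm ((Matrix.of fun (i : Fin r) (k : Fin q) => b k i)ᵀ.mulVec (W j)) ^ 2 := by
  simp only [vnorm_sq]
  rw [Finset.sum_comm]
  refine Finset.sum_congr rfl fun j _ => Finset.sum_congr rfl fun k _ => ?_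
  congr 1
  exact dotProduct_comm _ _

variable {W b}

lemma sum_vnorm_mulVec_sq_le {S : ℝ} (hW : frob W = 1)
    (hS : spec (Matrix.of fun (i : Fin r) (k : Fin q) => b k i) ≤ S) :
    ∑ k, vnorm (W.mulVec (b k)) ^ 2 ≤ S ^ 2 := by
  have hF := frob_sq W
  rw [hW, one_pow] at hF
  rw [sum_vnorm_mulVec_sq, ← mul_one (S ^ 2), hF, Finset.mul_sum]
  refine Finset.sum_le_sum fun j _ => ?_
  rw [← mul_pow]
  exact pow_le_pow_left₀ (vnorm_nonneg _) ((vnorm_transpose_mulVec_le_spec _ _).trans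
    (mul_le_mul_of_nonneg_right hS (vnorm_nonneg _))) 2

lemma le_sum_vnorm_mulVec_sq {S : ℝ} (hW : frob W = 1) (hS0 : 0 ≤ S)
    (hS : S ≤ sigMin (Matrix.of fun (i : Fin r) (k : Fin q) => b k i)) :
    S ^ 2 ≤ ∑ k, vnorm (W.mulVec (b k)) ^ 2 := by
  have hF := frob_sq W
  rw [hW, one_pow] at hF
  rw [sum_vnorm_mulVec_sq, ← mul_one (S ^ 2), hF, Finset.mul_sum]
  refine Finset.sum_le_sum fun j _ => ?_
  rw [← mul_pow]
  exact pow_le_pow_left₀ (mul_nonneg hS0 (vnorm_nonneg _))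
    ((mul_le_mul_of_nonneg_right hS (vnorm_nonneg _)).trans (sigMin_mul_vnorm_le _ _)) 2

end Columns

section Form

variable {n r q m : ℕ}

/-- The linear functional `W ↦ aᵀ W b` on matrices with the Frobenius inner product. -/
def matFunctional (a : Fin n → ℝ) (b : Fin r → ℝ) :
    EuclideanSpace ℝ (Fin n × Fin r) →ₗ[ℝ] ℝ where
  toFun x := a ⬝ᵥ (Matrix.of fun i j => x (i, j)).mulVec b
  map_add' x y := by
    rw [← dotProduct_add, ← add_mulVec]
    rfl
  map_smul' c x := by
    rw [RingHom.id_apply, ← dotProduct_smul, ← smul_mulVec]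
    rfl

lemma matFunctional_apply (a : Fin n → ℝ) (b : Fin r → ℝ)
    (x : EuclideanSpace ℝ (Fin n × Fin r)) :
    matFunctional a b x = a ⬝ᵥ (Matrix.of fun i j => x (i, j)).mulVec b := rfl

/-- The centered Hessian quadratic form. -/
def hessianDeviation (b : Fin q → Fin r → ℝ) (ω : Fin q → Fin m → Fin n → ℝ) :
    QuadraticForm ℝ (EuclideanSpace ℝ (Fin n × Fin r)) :=
  ∑ k, ∑ i, (QuadraticMap.sq.comp (matFunctional (ω k i) (b k)) -
    ∑ j, QuadraticMap.sq.comp (matFunctional (Pi.single j 1) (b k)))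

lemma hessianDeviation_apply (b : Fin q → Fin r → ℝ) (ω : Fin q → Fin m → Fin n → ℝ)
    (x : EuclideanSpace ℝ (Fin n × Fin r)) :
    hessianDeviation b ω x =
      centeredSumSq (fun k => (Matrix.of fun i j => x (i, j)).mulVec (b k)) ω := by
  simp only [centeredSumSq, vnorm_sq]
  simp [hessianDeviation, matFunctional_apply, sq]

lemma continuous_hessianDeviation (b : Fin q → Fin r → ℝ) (ω : Fin q → Fin m → Fin n → ℝ) :
    Continuous (hessianDeviation b ω) := by
  have h (a : Fin n → ℝ) (c : Fin r → ℝ) : Continuous (matFunctional a c) :=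
    LinearMap.continuous_of_finiteDimensional _
  have heq : (hessianDeviation b ω : _ → ℝ) = fun x => ∑ k, ∑ i,
      (matFunctional (ω k i) (b k) x * matFunctional (ω k i) (b k) x -
        ∑ j, matFunctional (Pi.single j 1) (b k) x * matFunctional (Pi.single j 1) (b k) x) := by
    ext x
    simp [hessianDeviation]
  rw [heq]
  fun_prop

lemma norm_eq_frob (x : EuclideanSpace ℝ (Fin n × Fin r)) :
    ‖x‖ = frob (Matrix.of fun i j => x (i, j)) := by
  simp [EuclideanSpace.norm_eq, frob, Fintype.sum_prod_type]

/-- Uniform concentration of the Hessian quadratic form over the Frobenius unit sphere. -/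
lemma measureReal_exists_lt_abs_centeredSumSq_le (b : Fin q → Fin r → ℝ) {K V t : ℝ}
    (ht : 0 ≤ t) (hV0 : 0 < V) (htK : t * K ≤ 2 * V)
    (hK : ∀ W : Matrix (Fin n) (Fin r) ℝ, frob W = 1 → ∀ k, vnorm (W.mulVec (b k)) ^ 2 ≤ K)
    (hV : ∀ W : Matrix (Fin n) (Fin r) ℝ, frob W = 1 → ∑ k, vnorm (W.mulVec (b k)) ^ 4 ≤ V) :
    (gaussianMatrices q m n).real {ω | ∃ W : Matrix (Fin n) (Fin r) ℝ, frob W = 1 ∧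
        32 * (m * t) < |centeredSumSq (fun k => W.mulVec (b k)) ω|} ≤
      5 ^ (n * r) * (2 * Real.exp (-(m * t ^ 2 / (16 * V)))) := by
  obtain ⟨s, hcard, hs1, hs⟩ := exists_half_net_sphere (EuclideanSpace ℝ (Fin n × Fin r))
  rw [finrank_euclideanSpace, Fintype.card_prod, Fintype.card_fin, Fintype.card_fin] at hcard
  have hsub : {ω : Fin q → Fin m → Fin n → ℝ | ∃ W : Matrix (Fin n) (Fin r) ℝ, frob W = 1 ∧
        32 * (m * t) < |centeredSumSq (fun k => W.mulVec (b k)) ω|} ⊆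
      ⋃ y ∈ s, {ω | m * t ≤ |hessianDeviation b ω y|} := by
    rintro ω ⟨W, hW, hlt⟩
    by_contra hω
    simp only [Set.mem_iUnion, Set.mem_ofPred_eq, not_exists, not_le] at hω
    have h := abs_quadraticForm_le_of_net (hessianDeviation b ω)
      (continuous_hessianDeviation b ω) hs1 hs (fun y hy => (hω y hy).le)
      (WithLp.toLp 2 fun p => W p.1 p.2) (by rw [norm_eq_frob]; exact hW)
    rw [hessianDeviation_apply] at h
    exact absurd hlt (not_lt.mpr h)
  calc _ ≤ (gaussianMatrices q m n).real (⋃ y ∈ s, {ω | m * t ≤ |hessianDeviation b ω y|}) :=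
        measureReal_mono hsub (measure_ne_top _ _)
    _ ≤ ∑ y ∈ s, (gaussianMatrices q m n).real {ω | m * t ≤ |hessianDeviation b ω y|} :=
        measureReal_biUnion_finset_le _ _
    _ ≤ ∑ y ∈ s, 2 * Real.exp (-(m * t ^ 2 / (16 * V))) := by
        refine Finset.sum_le_sum fun y hy => ?_
        have hy1 := hs1 y hy
        rw [norm_eq_frob] at hy1
        simp only [hessianDeviation_apply]
        exact measureReal_le_abs_centeredSumSq ht hV0 (hK _ hy1) (hV _ hy1) htK
    _ = s.card * (2 * Real.exp (-(m * t ^ 2 / (16 * V)))) := by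
        rw [Finset.sum_const, nsmul_eq_mul]
    _ ≤ _ := by
        gcongr
        exact_mod_cast hcard

end Form

lemma centeredSumSq_eq {n q m : ℕ} (v : Fin q → Fin n → ℝ) (ω : Fin q → Fin m → Fin n → ℝ) :
    centeredSumSq v ω = ∑ k, ∑ i, (ω k i ⬝ᵥ v k) ^ 2 - m * ∑ k, vnorm (v k) ^ 2 := by
  simp [centeredSumSq, Finset.sum_sub_distrib, Finset.mul_sum]

lemma five_pow_mul_two_le_exp {d : ℕ} (hd : 0 < d) : (5 : ℝ) ^ d * 2 ≤ Real.exp (3 * d) := by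
  have h1 : (10 : ℝ) ≤ Real.exp 3 := by
    have h := Real.exp_one_gt_d9.le
    have h3 : Real.exp 3 = Real.exp 1 ^ 3 := by rw [← Real.exp_nat_mul]; norm_num
    rw [h3]
    calc (10 : ℝ) ≤ 2.7182818283 ^ 3 := by norm_num
      _ ≤ _ := by gcongr
  have h2 : (2 : ℝ) ≤ 2 ^ d := le_self_pow₀ one_le_two hd.ne'
  calc (5 : ℝ) ^ d * 2 ≤ 5 ^ d * 2 ^ d := by gcongr
    _ = 10 ^ d := by rw [← mul_pow]; norm_num
    _ ≤ Real.exp 3 ^ d := by gcongr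
    _ = Real.exp (3 * d) := by rw [← Real.exp_nat_mul, mul_comm]

/-- **Lemma 3.5, part 3** (two-sided bound on the Hessian quadratic form). -/
theorem lemma35_part3 :
    ∃ c C : ℝ, 0 < c ∧ 0 < C ∧
    ∀ (n r q m : ℕ), r ≤ q →
    ∀ (σp σm κ μ ε₃ : ℝ), 0 < σm → σm ≤ σp → κ = σp / σm → 1 ≤ μ → 0 < ε₃ → ε₃ < 1 →
    ∀ bhat : Fin q → Fin r → ℝ,
      (∀ k, vnorm (bhat k) ≤ 1.1 * μ * σp * Real.sqrt ((r : ℝ) / q)) →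
      0.9 * σm ≤ sigMin (Matrix.of fun (i : Fin r) (k : Fin q) => bhat k i) →
      spec (Matrix.of fun (i : Fin r) (k : Fin q) => bhat k i) ≤ 1.04 * σp →
      ENNReal.ofReal (1 - Real.exp (C * ((n : ℝ) * r) * (1 + Real.log κ) -
          c * m * q * ε₃ ^ 2 / (r * κ ^ 4 * μ ^ 2))) ≤
        gaussianMatrices q m n {ω | ∀ W : Matrix (Fin n) (Fin r) ℝ, frob W = 1 →
          m * (0.65 - 1.2 * ε₃) * σm ^ 2 ≤ ∑ k, ∑ i, (ω k i ⬝ᵥ W.mulVec (bhat k)) ^ 2 ∧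
          ∑ k, ∑ i, (ω k i ⬝ᵥ W.mulVec (bhat k)) ^ 2 ≤ m * (1.1 + ε₃) * σp ^ 2} := by
  refine ⟨1 / 32768, 3, by norm_num, by norm_num, ?_⟩
  intro n r q m hrq σp σm κ μ ε hσm hσ hκ hμ hε hε1 b hb hsig hspec
  have hσp : 0 < σp := hσm.trans_le hσ
  rcases Nat.eq_zero_or_pos (n * r) with hnr | hnr
  · have huniv : {ω : Fin q → Fin m → Fin n → ℝ | ∀ W : Matrix (Fin n) (Fin r) ℝ, frob W = 1 →
          m * (0.65 - 1.2 * ε) * σm ^ 2 ≤ ∑ k, ∑ i, (ω k i ⬝ᵥ W.mulVec (b k)) ^ 2 ∧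
          ∑ k, ∑ i, (ω k i ⬝ᵥ W.mulVec (b k)) ^ 2 ≤ m * (1.1 + ε) * σp ^ 2} = Set.univ := by
      refine Set.eq_univ_of_forall fun ω W hW => ?_
      exfalso
      rcases Nat.mul_eq_zero.mp hnr with rfl | rfl <;> simp [frob] at hW
    rw [huniv, measure_univ, ENNReal.ofReal_le_one]
    linarith [Real.exp_pos (3 * ((n : ℝ) * r) * (1 + Real.log κ) -
      1 / 32768 * m * q * ε ^ 2 / (r * κ ^ 4 * μ ^ 2))]
  have hr : 0 < r := Nat.pos_of_mul_pos_left hnr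
  have hr' : (0 : ℝ) < r := Nat.cast_pos.mpr hr
  have hq' : (0 : ℝ) < q := Nat.cast_pos.mpr (hr.trans_le hrq)
  have hμ0 : 0 < μ := one_pos.trans_le hμ
  set ρ : ℝ := μ ^ 2 * ((r : ℝ) / q) with hρ
  have hρ0 : 0 < ρ := by positivity
  have hK (W : Matrix (Fin n) (Fin r) ℝ) (hW : frob W = 1) (k : Fin q) :
      vnorm (W.mulVec (b k)) ^ 2 ≤ 1.21 * ρ * σp ^ 2 := by
    have h := vnorm_mulVec_le_frob W (b k)
    rw [hW, one_mul] at h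
    calc vnorm (W.mulVec (b k)) ^ 2 ≤ (1.1 * μ * σp * Real.sqrt ((r : ℝ) / q)) ^ 2 :=
          pow_le_pow_left₀ (vnorm_nonneg _) (h.trans (hb k)) 2
      _ = 1.21 * ρ * σp ^ 2 := by
          rw [mul_pow, Real.sq_sqrt (by positivity), hρ]; ring
  have hV (W : Matrix (Fin n) (Fin r) ℝ) (hW : frob W = 1) :
      ∑ k, vnorm (W.mulVec (b k)) ^ 4 ≤ 2 * ρ * σp ^ 4 := by
    calc ∑ k, vnorm (W.mulVec (b k)) ^ 4
        ≤ ∑ k, 1.21 * ρ * σp ^ 2 * vnorm (W.mulVec (b k)) ^ 2 := by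
          refine Finset.sum_le_sum fun k _ => ?_
          rw [show vnorm (W.mulVec (b k)) ^ 4 =
            vnorm (W.mulVec (b k)) ^ 2 * vnorm (W.mulVec (b k)) ^ 2 by ring]
          exact mul_le_mul_of_nonneg_right (hK W hW k) (sq_nonneg _)
      _ = 1.21 * ρ * σp ^ 2 * ∑ k, vnorm (W.mulVec (b k)) ^ 2 := by rw [Finset.mul_sum]
      _ ≤ 1.21 * ρ * σp ^ 2 * (1.04 * σp) ^ 2 := by
          gcongr; exact sum_vnorm_mulVec_sq_le hW hspec
      _ = 1.308736 * (ρ * σp ^ 4) := by ring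
      _ ≤ 2 * ρ * σp ^ 4 := by nlinarith [show 0 < ρ * σp ^ 4 by positivity]
  have htK : ε * σm ^ 2 / 32 * (1.21 * ρ * σp ^ 2) ≤ 2 * (2 * ρ * σp ^ 4) := by
    have hle : ε * σm ^ 2 ≤ 1 * σp ^ 2 := by gcongr
    have h : ε * σm ^ 2 * (ρ * σp ^ 2) ≤ 1 * σp ^ 2 * (ρ * σp ^ 2) := by gcongr
    nlinarith [show 0 < ρ * σp ^ 4 by positivity]
  have hbad := measureReal_exists_lt_abs_centeredSumSq_le (m := m) b
    (show 0 ≤ ε * σm ^ 2 / 32 by positivity) (show 0 < 2 * ρ * σp ^ 4 by positivity) htK hK hV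
  set bad : Set (Fin q → Fin m → Fin n → ℝ) := {ω | ∃ W : Matrix (Fin n) (Fin r) ℝ,
    frob W = 1 ∧ 32 * (m * (ε * σm ^ 2 / 32)) < |centeredSumSq (fun k => W.mulVec (b k)) ω|}
  have hexponent : m * (ε * σm ^ 2 / 32) ^ 2 / (16 * (2 * ρ * σp ^ 4)) =
      1 / 32768 * m * q * ε ^ 2 / (r * κ ^ 4 * μ ^ 2) := by
    rw [hκ, hρ]
    field_simp
    ring
  have hlog : 0 ≤ Real.log κ := by
    rw [hκ]
    exact Real.log_nonneg ((one_le_div hσm).mpr hσ)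
  have hprob : (gaussianMatrices q m n).real bad ≤ Real.exp (3 * ((n : ℝ) * r) *
      (1 + Real.log κ) - 1 / 32768 * m * q * ε ^ 2 / (r * κ ^ 4 * μ ^ 2)) := by
    refine hbad.trans ?_
    rw [hexponent, ← mul_assoc, sub_eq_add_neg, Real.exp_add]
    refine mul_le_mul_of_nonneg_right ((five_pow_mul_two_le_exp hnr).trans ?_)
      (Real.exp_pos _).le
    rw [Real.exp_le_exp]
    push_cast
    nlinarith [mul_nonneg (show (0 : ℝ) ≤ n * r by positivity) hlog]
  refine ENNReal.ofReal_le_of_le_toReal ?_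
  change _ ≤ (gaussianMatrices q m n).real _
  set good : Set (Fin q → Fin m → Fin n → ℝ) := {ω | ∀ W : Matrix (Fin n) (Fin r) ℝ,
    frob W = 1 → m * (0.65 - 1.2 * ε) * σm ^ 2 ≤ ∑ k, ∑ i, (ω k i ⬝ᵥ W.mulVec (b k)) ^ 2 ∧
      ∑ k, ∑ i, (ω k i ⬝ᵥ W.mulVec (b k)) ^ 2 ≤ m * (1.1 + ε) * σp ^ 2}
  have hcover : (Set.univ : Set (Fin q → Fin m → Fin n → ℝ)) ⊆ good ∪ bad := by
    intro ω _
    by_contra hω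
    rw [Set.mem_union, not_or] at hω
    refine hω.1 fun W hW => ?_
    have hdev : |centeredSumSq (fun k => W.mulVec (b k)) ω| ≤ m * (ε * σm ^ 2) := by
      by_contra! h
      exact hω.2 ⟨W, hW, by linarith⟩
    rw [centeredSumSq_eq, abs_le] at hdev
    have hm : (0 : ℝ) ≤ m := Nat.cast_nonneg m
    have hup := mul_le_mul_of_nonneg_left (sum_vnorm_mulVec_sq_le hW hspec) hm
    have hlo := mul_le_mul_of_nonneg_left
      (le_sum_vnorm_mulVec_sq hW (by positivity) hsig) hm
    have h1 : m * (ε * σm ^ 2) ≤ m * (ε * σp ^ 2) := by gcongr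
    have h2 : 0 ≤ m * (ε * σm ^ 2) := by positivity
    have h3 : 0 ≤ m * σm ^ 2 := by positivity
    have h4 : 0 ≤ m * σp ^ 2 := by positivity
    constructor <;> nlinarith
  have htotal : 1 ≤ (gaussianMatrices q m n).real good + (gaussianMatrices q m n).real bad := by
    calc (1 : ℝ) = (gaussianMatrices q m n).real Set.univ := by rw [probReal_univ]
      _ ≤ (gaussianMatrices q m n).real (good ∪ bad) := measureReal_mono hcover
      _ ≤ _ := measureReal_union_le _ _
  linarith
end

section
/- Lemma 3.8, part 1 (spectral-norm concentration of the truncated initialization, fixed threshold). There exists a universal constant c > 0 such that the following holds. Assume Assumption 1 and let the a_ki and y_ki be as in the context, with C̃ := 9κ²μ². Fix ε₁ ∈ (0,1) and a deterministic threshold α with C̃(1 − ε₁)‖X*‖_F²/q ≤ α ≤ C̃(1 + ε₁)‖X*‖_F²/q. Let X̂₀(α) := (1/m)·Σ_{k,i} a_ki·y_ki·1{y_ki² ≤ α}·e_kᵀ and let D(α) be the q×q diagonal matrix with entries β_k(α) := E[ζ²·1{‖x*_k‖²ζ² ≤ α}] (ζ standard Gaussian), so that E[X̂₀(α)] = X*·D(α).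 Then with probability at least 1 − exp((n+q) − c·ε₁²·mq/(μ²κ²)), ‖X̂₀(α) − X*·D(α)‖ ≤ 1.1·ε₁·‖X*‖_F. -/
open MeasureTheory ProbabilityTheory Matrix
open scoped ENNReal

open scoped NNReal

section SubgaussianBound

lemma exp_le_add_exp_sq (x : ℝ) : Real.exp x ≤ x + Real.exp (x ^ 2) := by
  have h2 := Real.add_one_le_exp (x ^ 2)
  rcases le_total |x| 1 with hx | hx
  · have h := Real.abs_exp_sub_one_sub_id_le hx
    have := (abs_le.1 h).2
    linarith
  · rcases le_total 0 x with h0 | h0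
    · rw [abs_of_nonneg h0] at hx
      have : Real.exp x ≤ Real.exp (x ^ 2) := Real.exp_le_exp.2 (by nlinarith)
      linarith
    · rw [abs_of_nonpos h0] at hx
      have : Real.exp x ≤ 1 := Real.exp_le_one_iff.2 h0
      nlinarith

lemma gaussianReal_eq_map_mul (v : ℝ≥0) :
    gaussianReal 0 v = (gaussianReal 0 1).map (fun x => Real.sqrt v * x) := by
  have h := gaussianReal_map_const_mul (μ := 0) (v := 1) (Real.sqrt v)
  rw [h]
  congr 1
  · simp
  · ext
    simp

lemma integrable_exp_mul_sq_gaussianReal_one {s : ℝ} (hs : s < 1 / 2) :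
    Integrable (fun x => Real.exp (s * x ^ 2)) (gaussianReal 0 1) := by
  rw [gaussianReal_of_var_ne_zero _ one_ne_zero,
    integrable_withDensity_iff_integrable_smul' (measurable_gaussianPDF _ _)
      (ae_of_all _ fun x => by simp [gaussianPDF])]
  have h := (integrable_exp_neg_mul_sq (b := 1 / 2 - s) (by linarith)).const_mul
    (Real.sqrt (2 * Real.pi))⁻¹
  refine h.congr (ae_of_all _ fun x => ?_)
  simp only [toReal_gaussianPDF, gaussianPDFReal, smul_eq_mul, NNReal.coe_one, mul_one, sub_zero]
  rw [mul_assoc, ← Real.exp_add]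
  congr 2
  ring

lemma integral_exp_mul_sq_gaussianReal_one {s : ℝ} (hs : s < 1 / 2) :
    ∫ x, Real.exp (s * x ^ 2) ∂(gaussianReal 0 1) = Real.sqrt (1 / (1 - 2 * s)) := by
  rw [integral_gaussianReal_eq_integral_smul one_ne_zero]
  have : ∀ x : ℝ, gaussianPDFReal 0 1 x • Real.exp (s * x ^ 2) =
      (Real.sqrt (2 * Real.pi))⁻¹ * Real.exp (-(1 / 2 - s) * x ^ 2) := by
    intro x
    simp only [gaussianPDFReal, smul_eq_mul, NNReal.coe_one, mul_one, sub_zero]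
    rw [mul_assoc, ← Real.exp_add]
    congr 2
    ring
  simp_rw [this]
  rw [integral_const_mul, integral_gaussian, ← Real.sqrt_inv, ← Real.sqrt_mul (by positivity)]
  congr 1
  have : (1 - 2 * s) ≠ 0 := by linarith
  have : (1 / 2 - s) ≠ 0 := by linarith
  field_simp

lemma integrable_exp_mul_sq_gaussianReal {s : ℝ} {v : ℝ≥0} (hs : s * v < 1 / 2) :
    Integrable (fun x => Real.exp (s * x ^ 2)) (gaussianReal 0 v) := by
  rw [gaussianReal_eq_map_mul, integrable_map_measure (by fun_prop) (by fun_prop)]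
  refine (integrable_exp_mul_sq_gaussianReal_one hs).congr (ae_of_all _ fun x => ?_)
  simp only [Function.comp, mul_pow, Real.sq_sqrt v.coe_nonneg]
  ring_nf

lemma integral_exp_mul_sq_gaussianReal_le {s : ℝ} {v : ℝ≥0} (h0 : 0 ≤ s) (hs : s * v ≤ 1 / 4) :
    ∫ x, Real.exp (s * x ^ 2) ∂(gaussianReal 0 v) ≤ Real.exp (2 * (s * v)) := by
  rw [gaussianReal_eq_map_mul, integral_map (by fun_prop) (by fun_prop)]
  have : ∀ x : ℝ, s * (Real.sqrt v * x) ^ 2 = s * v * x ^ 2 := by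
    intro x
    rw [mul_pow, Real.sq_sqrt v.coe_nonneg, mul_assoc]
  simp_rw [this]
  rw [integral_exp_mul_sq_gaussianReal_one (by linarith)]
  set u : ℝ := s * v
  have hu : 0 ≤ u := mul_nonneg h0 v.coe_nonneg
  rw [Real.sqrt_le_left (Real.exp_pos _).le, ← Real.exp_nat_mul, div_le_iff₀ (by linarith)]
  have h := Real.quadratic_le_exp_of_nonneg (x := ((2 : ℕ) : ℝ) * (2 * u)) (by positivity)
  push_cast at h ⊢
  have h3 : (1 + 2 * (2 * u) + (2 * (2 * u)) ^ 2 / 2) * (1 - 2 * u) ≤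
      Real.exp (2 * (2 * u)) * (1 - 2 * u) := mul_le_mul_of_nonneg_right h (by linarith)
  nlinarith [mul_nonneg hu hu, mul_nonneg hu (mul_nonneg hu hu)]

lemma integral_sq_gaussianReal (v : ℝ≥0) : ∫ x, x ^ 2 ∂(gaussianReal 0 v) = v := by
  have h := variance_fun_id_gaussianReal (μ := 0) (v := v)
  rwa [variance_of_integral_eq_zero (by fun_prop) (by simp)] at h

/-- A random variable dominated by a centered Gaussian of variance `v` is, once centered,
sub-Gaussian with parameter `16 * v`. -/
lemma hasSubgaussianMGF_sub_integral_of_abs_le {Ω : Type*} [MeasurableSpace Ω] {P : Measure Ω}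
    [IsProbabilityMeasure P] {X g : Ω → ℝ} {v : ℝ≥0} (hX : AEStronglyMeasurable X P)
    (hg : HasLaw g (gaussianReal 0 v) P) (hXg : ∀ ω, |X ω| ≤ |g ω|) :
    HasSubgaussianMGF (fun ω => X ω - ∫ ω', X ω' ∂P) (16 * v) P := by
  have hgm : AEMeasurable g P := hg.aemeasurable
  have hexp : ∀ s : ℝ, s * v < 1 / 2 → Integrable (fun ω => Real.exp (s * g ω ^ 2)) P := by
    intro s hs
    have h := integrable_exp_mul_sq_gaussianReal (s := s) (v := v) hs
    rw [← hg.map_eq, integrable_map_measure (by fun_prop) hgm] at h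
    exact h
  have hexple : ∀ s : ℝ, 0 ≤ s → s * v ≤ 1 / 4 →
      ∫ ω, Real.exp (s * g ω ^ 2) ∂P ≤ Real.exp (2 * (s * v)) := by
    intro s h0 hs
    have h := integral_exp_mul_sq_gaussianReal_le (s := s) (v := v) h0 hs
    rw [← hg.map_eq, integral_map hgm (by fun_prop)] at h
    exact h
  have hgL : MemLp g 2 P := by
    have h : MemLp (id : ℝ → ℝ) 2 (gaussianReal 0 v) := memLp_id_gaussianReal 2
    rw [← hg.map_eq, memLp_map_measure_iff (by fun_prop) hgm] at h
    exact h
  have hXL : MemLp X 2 P := hgL.mono hX (ae_of_all _ fun ω => by simpa using hXg ω)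
  have hXi : Integrable X P := hXL.integrable (by norm_num)
  set e := ∫ ω', X ω' ∂P with he
  have hYi : Integrable (fun ω => X ω - e) P := hXi.sub (integrable_const e)
  have hY0 : ∫ ω, (X ω - e) ∂P = 0 := by
    rw [integral_sub hXi (integrable_const e)]
    simp [he]
  have hsq : e ^ 2 ≤ v := by
    have h1 : 0 ≤ Var[X; P] := variance_nonneg X P
    rw [variance_eq_sub hXL] at h1
    have h2 : ∫ ω, X ω ^ 2 ∂P ≤ ∫ ω, g ω ^ 2 ∂P :=
      integral_mono hXL.integrable_sq hgL.integrable_sq fun ω => sq_le_sq.2 (hXg ω)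
    have h3 : ∫ ω, g ω ^ 2 ∂P = v := by
      have h := integral_sq_gaussianReal v
      rw [← hg.map_eq, integral_map hgm (by fun_prop)] at h
      exact h
    have h4 : ∫ ω, (X ^ 2) ω ∂P = ∫ ω, X ω ^ 2 ∂P := rfl
    rw [h4] at h1
    linarith
  have hYsq : ∀ ω, (X ω - e) ^ 2 ≤ 2 * g ω ^ 2 + 2 * v := by
    intro ω
    have := sq_le_sq.2 (hXg ω)
    nlinarith [sq_nonneg (X ω + e)]
  have hv : (0 : ℝ) ≤ v := v.coe_nonneg
  have key : ∀ t : ℝ, Integrable (fun ω => Real.exp (t * (X ω - e))) P ∧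
      ∫ ω, Real.exp (t * (X ω - e)) ∂P ≤ Real.exp (8 * v * t ^ 2) := by
    intro t
    have hmeas : AEStronglyMeasurable (fun ω => Real.exp (t * (X ω - e))) P := by fun_prop
    rcases le_total (8 * t ^ 2 * v) 1 with ht | ht
    · set D : Ω → ℝ := fun ω =>
        t * (X ω - e) + Real.exp (2 * t ^ 2 * v) * Real.exp (2 * t ^ 2 * g ω ^ 2)
      have hE := hexp (2 * t ^ 2) (by linarith)
      have hD : Integrable D P := (hYi.const_mul t).add (hE.const_mul _)
      have hle : ∀ ω, Real.exp (t * (X ω - e)) ≤ D ω := by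
        intro ω
        refine (exp_le_add_exp_sq _).trans ?_
        simp only [D]
        rw [← Real.exp_add]
        gcongr
        nlinarith [mul_le_mul_of_nonneg_left (hYsq ω) (sq_nonneg t)]
      have hint : Integrable (fun ω => Real.exp (t * (X ω - e))) P :=
        hD.mono' hmeas (ae_of_all _ fun ω => by
          rw [Real.norm_eq_abs, abs_of_pos (Real.exp_pos _)]; exact hle ω)
      refine ⟨hint, (integral_mono hint hD hle).trans ?_⟩
      simp only [D]
      rw [integral_add (hYi.const_mul t) (hE.const_mul _), integral_const_mul, integral_const_mul,
        hY0, mul_zero, zero_add]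
      calc _ ≤ Real.exp (2 * t ^ 2 * v) * Real.exp (2 * (2 * t ^ 2 * v)) := by
            gcongr
            exact hexple _ (by positivity) (by linarith)
        _ ≤ _ := by
            rw [← Real.exp_add]
            gcongr
            nlinarith [mul_nonneg (sq_nonneg t) hv]
    · have hv0 : (0 : ℝ) < v := by
        rcases hv.eq_or_lt with h | h
        · rw [← h] at ht; norm_num at ht
        · exact h
      set D : Ω → ℝ := fun ω =>
        Real.exp (1 / 4 + 2 * t ^ 2 * v) * Real.exp (1 / (4 * v) * g ω ^ 2)
      have hE := hexp (1 / (4 * v)) (by field_simp; norm_num)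
      have hD : Integrable D P := hE.const_mul _
      have hle : ∀ ω, Real.exp (t * (X ω - e)) ≤ D ω := by
        intro ω
        simp only [D]
        rw [← Real.exp_add]
        gcongr
        have h1 : t * (X ω - e) ≤ (X ω - e) ^ 2 / (8 * v) + 2 * t ^ 2 * v := by
          rw [div_add' _ _ _ (by positivity), le_div_iff₀ (by positivity)]
          nlinarith [sq_nonneg (X ω - e - 4 * v * t)]
        have h2 : (X ω - e) ^ 2 / (8 * v) ≤ (2 * g ω ^ 2 + 2 * v) / (8 * v) := by
          gcongr
          exact hYsq ω
        have h3 : (2 * g ω ^ 2 + 2 * v) / (8 * v) = 1 / (4 * v) * g ω ^ 2 + 1 / 4 := by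
          field_simp
          ring
        linarith
      have hint : Integrable (fun ω => Real.exp (t * (X ω - e))) P :=
        hD.mono' hmeas (ae_of_all _ fun ω => by
          rw [Real.norm_eq_abs, abs_of_pos (Real.exp_pos _)]; exact hle ω)
      refine ⟨hint, (integral_mono hint hD hle).trans ?_⟩
      simp only [D]
      rw [integral_const_mul]
      have h4 : 1 / (4 * (v : ℝ)) * v = 1 / 4 := by field_simp
      calc _ ≤ Real.exp (1 / 4 + 2 * t ^ 2 * v) * Real.exp (2 * (1 / (4 * v) * v)) := by
            gcongr
            exact hexple _ (by positivity) h4.le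
        _ ≤ _ := by
            rw [← Real.exp_add, h4]
            gcongr
            nlinarith
  refine ⟨fun t => (key t).1, fun t => (key t).2.trans_eq ?_⟩
  congr 1
  push_cast
  ring

lemma ProbabilityTheory.HasSubgaussianMGF.mono {Ω : Type*} [MeasurableSpace Ω] {P : Measure Ω}
    {X : Ω → ℝ} {c c' : ℝ≥0} (h : HasSubgaussianMGF X c P) (hc : c ≤ c') :
    HasSubgaussianMGF X c' P :=
  ⟨h.integrable_exp_mul, fun t => (h.mgf_le t).trans (by gcongr)⟩

lemma hasSubgaussianMGF_sum_pi {ι : Type*} [Fintype ι] {Ω : ι → Type*}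
    [∀ i, MeasurableSpace (Ω i)] {P : ∀ i, Measure (Ω i)} [∀ i, IsProbabilityMeasure (P i)]
    {X : ∀ i, Ω i → ℝ} {c : ι → ℝ≥0} (h : ∀ i, HasSubgaussianMGF (X i) (c i) (P i)) :
    HasSubgaussianMGF (fun ω : ∀ i, Ω i => ∑ i, X i (ω i)) (∑ i, c i) (Measure.pi P) := by
  refine HasSubgaussianMGF.sum_of_iIndepFun (iIndepFun_pi fun i => (h i).aemeasurable) ?_
  intro i _
  refine HasSubgaussianMGF.of_map (measurable_pi_apply i).aemeasurable ?_
  rw [(measurePreserving_eval P i).map_eq]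
  exact h i

end SubgaussianBound

section GaussianVector

variable {n : ℕ}

lemma hasLaw_eval_gaussianVec (i : Fin n) :
    HasLaw (fun a : Fin n → ℝ => a i) (gaussianReal 0 1) (gaussianVec n) :=
  ⟨(measurable_pi_apply i).aemeasurable,
    (measurePreserving_eval (fun _ : Fin n => gaussianReal 0 1) i).map_eq⟩

lemma iIndepFun_eval_gaussianVec :
    iIndepFun (fun (i : Fin n) (a : Fin n → ℝ) => a i) (gaussianVec n) :=
  iIndepFun_pi (X := fun _ x => x) (fun _ => aemeasurable_id')

lemma hasGaussianLaw_id_gaussianVec :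
    HasGaussianLaw (fun a : Fin n → ℝ => a) (gaussianVec n) :=
  iIndepFun_eval_gaussianVec.hasGaussianLaw fun i => (hasLaw_eval_gaussianVec i).hasGaussianLaw

lemma memLp_eval_gaussianVec (i : Fin n) :
    MemLp (fun a : Fin n → ℝ => a i) 2 (gaussianVec n) :=
  (hasLaw_eval_gaussianVec i).hasGaussianLaw.memLp_two

lemma covariance_eval_gaussianVec (i j : Fin n) :
    cov[fun a : Fin n → ℝ => a i, fun a => a j; gaussianVec n] = if i = j then 1 else 0 := by
  split_ifs with h
  · subst h
    rw [covariance_self (measurable_pi_apply i).aemeasurable,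
      (hasLaw_eval_gaussianVec i).variance_eq]
    simp
  · exact (iIndepFun_eval_gaussianVec.indepFun h).covariance_eq_zero
      (memLp_eval_gaussianVec i) (memLp_eval_gaussianVec j)

lemma covariance_dotProduct_gaussianVec (x y : Fin n → ℝ) :
    cov[fun a : Fin n → ℝ => a ⬝ᵥ x, fun a => a ⬝ᵥ y; gaussianVec n] = x ⬝ᵥ y := by
  simp only [dotProduct]
  rw [covariance_fun_sum_fun_sum (fun i => (memLp_eval_gaussianVec i).mul_const _)
    (fun i => (memLp_eval_gaussianVec i).mul_const _)]
  simp [covariance_mul_const_left, covariance_mul_const_right, covariance_eval_gaussianVec]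

lemma integral_dotProduct_gaussianVec (x : Fin n → ℝ) :
    ∫ a, a ⬝ᵥ x ∂(gaussianVec n) = 0 := by
  simp only [dotProduct]
  rw [integral_finsetSum _ fun i _ =>
    ((memLp_eval_gaussianVec i).integrable (by norm_num)).mul_const _]
  refine Finset.sum_eq_zero fun i _ => ?_
  rw [integral_mul_const, (hasLaw_eval_gaussianVec i).integral_eq]
  simp

lemma hasGaussianLaw_dotProduct_gaussianVec (x : Fin n → ℝ) :
    HasGaussianLaw (fun a : Fin n → ℝ => a ⬝ᵥ x) (gaussianVec n) := by
  have h := hasGaussianLaw_id_gaussianVec.map_fun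
    (LinearMap.toContinuousLinearMap ((dotProductBilin ℝ ℝ).flip x))
  exact h

lemma hasLaw_dotProduct_gaussianVec (x : Fin n → ℝ) {v : ℝ≥0} (hv : (v : ℝ) = x ⬝ᵥ x) :
    HasLaw (fun a : Fin n → ℝ => a ⬝ᵥ x) (gaussianReal 0 v) (gaussianVec n) := by
  refine ⟨(hasGaussianLaw_dotProduct_gaussianVec x).aemeasurable, ?_⟩
  rw [(hasGaussianLaw_dotProduct_gaussianVec x).map_eq_gaussianReal,
    integral_dotProduct_gaussianVec,
    ← covariance_self (hasGaussianLaw_dotProduct_gaussianVec x).aemeasurable,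
    covariance_dotProduct_gaussianVec, ← hv, Real.toNNReal_coe]

lemma indepFun_dotProduct_gaussianVec {x y : Fin n → ℝ} (h : x ⬝ᵥ y = 0) :
    IndepFun (fun a : Fin n → ℝ => a ⬝ᵥ x) (fun a => a ⬝ᵥ y) (gaussianVec n) := by
  refine HasGaussianLaw.indepFun_of_covariance_eq_zero ?_
    (by rw [covariance_dotProduct_gaussianVec, h])
  exact hasGaussianLaw_id_gaussianVec.map_fun
    ((LinearMap.toContinuousLinearMap ((dotProductBilin ℝ ℝ).flip x)).prod
      (LinearMap.toContinuousLinearMap ((dotProductBilin ℝ ℝ).flip y)))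

lemma dotProduct_self_eq_vnorm_sq {ι : Type*} [Fintype ι] (x : ι → ℝ) :
    x ⬝ᵥ x = vnorm x ^ 2 := by
  rw [vnorm, Real.sq_sqrt (Finset.sum_nonneg fun _ _ => sq_nonneg _), dotProduct]
  exact Finset.sum_congr rfl fun i _ => (sq _).symm

/-- The summand `⟨a, d⟩ ⟨a, x⟩ 1{⟨a, x⟩² ≤ α}`. -/
noncomputable def truncProd (d x : Fin n → ℝ) (α : ℝ) (a : Fin n → ℝ) : ℝ :=
  (a ⬝ᵥ d) * ((a ⬝ᵥ x) * (if (a ⬝ᵥ x) ^ 2 ≤ α then 1 else 0))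

lemma measurable_mul_indicator_sq_le (α : ℝ) :
    Measurable fun y : ℝ => y * (if y ^ 2 ≤ α then 1 else 0) :=
  measurable_id.mul (Measurable.ite (measurableSet_le (by fun_prop) (by fun_prop))
    measurable_const measurable_const)

lemma measurable_dotProduct_right (x : Fin n → ℝ) :
    Measurable fun a : Fin n → ℝ => a ⬝ᵥ x := by
  unfold dotProduct
  fun_prop

lemma measurable_truncProd (d x : Fin n → ℝ) (α : ℝ) : Measurable (truncProd d x α) :=
  (measurable_dotProduct_right d).mul
    ((measurable_mul_indicator_sq_le α).comp (measurable_dotProduct_right x))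

lemma abs_mul_indicator_sq_le {α : ℝ} (y : ℝ) :
    |y * (if y ^ 2 ≤ α then 1 else 0)| ≤ Real.sqrt α := by
  split_ifs with h
  · rw [mul_one]
    exact Real.abs_le_sqrt h
  · simp

lemma abs_truncProd_le (d x : Fin n → ℝ) (α : ℝ) (a : Fin n → ℝ) :
    |truncProd d x α a| ≤ |a ⬝ᵥ (Real.sqrt α • d)| := by
  rw [truncProd, abs_mul, dotProduct_smul, smul_eq_mul, abs_mul (Real.sqrt α),
    abs_of_nonneg (Real.sqrt_nonneg α), mul_comm]
  gcongr
  exact abs_mul_indicator_sq_le _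

lemma integrable_truncProd (d x : Fin n → ℝ) (α : ℝ) :
    Integrable (truncProd d x α) (gaussianVec n) :=
  (hasGaussianLaw_dotProduct_gaussianVec (Real.sqrt α • d)).integrable.mono
    (measurable_truncProd d x α).aestronglyMeasurable
    (ae_of_all _ fun a => abs_truncProd_le d x α a)

lemma truncProd_add_left (d d' x : Fin n → ℝ) (α : ℝ) (a : Fin n → ℝ) :
    truncProd (d + d') x α a = truncProd d x α a + truncProd d' x α a := by
  simp only [truncProd, dotProduct_add]
  ring

lemma truncProd_smul_left (t : ℝ) (d x : Fin n → ℝ) (α : ℝ) (a : Fin n → ℝ) :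
    truncProd (t • d) x α a = t * truncProd d x α a := by
  simp only [truncProd, dotProduct_smul, smul_eq_mul]
  ring

lemma integral_truncProd_of_orthogonal {d x : Fin n → ℝ} (h : d ⬝ᵥ x = 0) (α : ℝ) :
    ∫ a, truncProd d x α a ∂(gaussianVec n) = 0 := by
  have hi := (indepFun_dotProduct_gaussianVec h).comp measurable_id
    (measurable_mul_indicator_sq_le α)
  have h2 := hi.integral_mul_eq_mul_integral
    (measurable_dotProduct_right d).aestronglyMeasurable
    ((measurable_mul_indicator_sq_le α).comp
      (measurable_dotProduct_right x)).aestronglyMeasurable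
  calc _ = _ := h2
    _ = 0 := by
      have : ∫ a, (id ∘ fun a : Fin n → ℝ => a ⬝ᵥ d) a ∂(gaussianVec n) = 0 :=
        integral_dotProduct_gaussianVec d
      rw [this, zero_mul]

lemma integral_truncProd_self (x : Fin n → ℝ) (α : ℝ) :
    ∫ a, truncProd x x α a ∂(gaussianVec n) = (x ⬝ᵥ x) * betaK (vnorm x) α := by
  have hx : 0 ≤ x ⬝ᵥ x := by rw [dotProduct_self_eq_vnorm_sq]; positivity
  obtain ⟨v, hv⟩ : ∃ v : ℝ≥0, (v : ℝ) = x ⬝ᵥ x := ⟨_, Real.coe_toNNReal _ hx⟩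
  have hlaw := hasLaw_dotProduct_gaussianVec x hv
  have hm : Measurable fun y : ℝ => y * (y * (if y ^ 2 ≤ α then 1 else 0)) :=
    measurable_id.mul (measurable_mul_indicator_sq_le α)
  have h1 : ∫ a, truncProd x x α a ∂(gaussianVec n) =
      ∫ y : ℝ, y * (y * (if y ^ 2 ≤ α then 1 else 0)) ∂(gaussianReal 0 v) := by
    rw [← hlaw.map_eq, integral_map hlaw.aemeasurable hm.aestronglyMeasurable]
    rfl
  rw [h1, gaussianReal_eq_map_mul, integral_map (by fun_prop) hm.aestronglyMeasurable, betaK,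
    ← integral_const_mul]
  refine integral_congr_ae (ae_of_all _ fun z => ?_)
  have hs : Real.sqrt (v : ℝ) ^ 2 = x ⬝ᵥ x := by rw [hv, Real.sq_sqrt hx]
  simp only [mul_pow, hs, ← dotProduct_self_eq_vnorm_sq]
  split_ifs
  · linear_combination z ^ 2 * hs
  · ring

lemma integral_truncProd (d x : Fin n → ℝ) (α : ℝ) :
    ∫ a, truncProd d x α a ∂(gaussianVec n) = (d ⬝ᵥ x) * betaK (vnorm x) α := by
  by_cases hx : x = 0
  · simp [hx, truncProd]
  have hxx : x ⬝ᵥ x ≠ 0 := fun h => hx (dotProduct_self_eq_zero.1 h)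
  set s : ℝ := (d ⬝ᵥ x) / (x ⬝ᵥ x)
  have hd : d = s • x + (d - s • x) := by simp
  have ho : (d - s • x) ⬝ᵥ x = 0 := by
    rw [sub_dotProduct, smul_dotProduct, smul_eq_mul, div_mul_cancel₀ _ hxx, sub_self]
  have h1 : ∀ a, truncProd d x α a = s * truncProd x x α a + truncProd (d - s • x) x α a := by
    intro a
    conv_lhs => rw [hd]
    rw [truncProd_add_left, truncProd_smul_left]
  simp_rw [h1]
  rw [integral_add ((integrable_truncProd _ _ _).const_mul _) (integrable_truncProd _ _ _),
    integral_const_mul, integral_truncProd_self, integral_truncProd_of_orthogonal ho, add_zero,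
    ← mul_assoc, div_mul_cancel₀ _ hxx]

lemma hasSubgaussianMGF_truncProd (d x : Fin n → ℝ) {α : ℝ} (hα : 0 ≤ α) {v : ℝ≥0}
    (hv : α * (d ⬝ᵥ d) ≤ v) :
    HasSubgaussianMGF (fun a => truncProd d x α a - (d ⬝ᵥ x) * betaK (vnorm x) α) (16 * v)
      (gaussianVec n) := by
  have hd : (Real.sqrt α • d) ⬝ᵥ (Real.sqrt α • d) = α * (d ⬝ᵥ d) := by
    rw [smul_dotProduct, dotProduct_smul, smul_eq_mul, smul_eq_mul, ← mul_assoc,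
      Real.mul_self_sqrt hα]
  have h0 : 0 ≤ α * (d ⬝ᵥ d) := by rw [dotProduct_self_eq_vnorm_sq]; positivity
  obtain ⟨w, hw⟩ : ∃ w : ℝ≥0, (w : ℝ) = α * (d ⬝ᵥ d) := ⟨_, Real.coe_toNNReal _ h0⟩
  have hwv : w ≤ v := by rw [← NNReal.coe_le_coe, hw]; exact hv
  have h := hasSubgaussianMGF_sub_integral_of_abs_le
    (measurable_truncProd d x α).aestronglyMeasurable
    (hasLaw_dotProduct_gaussianVec (Real.sqrt α • d) (hw.trans hd.symm))
    (abs_truncProd_le d x α)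
  rw [integral_truncProd] at h
  refine h.mono ?_
  gcongr

end GaussianVector

section Net

open Module

/-- The ball of radius `2` has a `1`-net of cardinality at most `5 ^ dim`. -/
lemma exists_finset_net_closedBall_two (E : Type*) [NormedAddCommGroup E] [NormedSpace ℝ E]
    [FiniteDimensional ℝ E] :
    ∃ N : Finset E, N.card ≤ 5 ^ finrank ℝ E ∧ (∀ c ∈ N, ‖c‖ ≤ 2) ∧
      ∀ v : E, ‖v‖ ≤ 2 → ∃ c ∈ N, ‖v - c‖ ≤ 1 := by
  classical
  let S : Finset E → Prop := fun N =>
    (∀ c ∈ N, ‖c‖ ≤ 2) ∧ ∀ c ∈ N, ∀ d ∈ N, c ≠ d → 1 ≤ ‖c - d‖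
  have hcard : ∀ N, S N → N.card ≤ 5 ^ finrank ℝ E := fun N hN =>
    Besicovitch.card_le_of_separated N hN.1 hN.2
  let T : Set ℕ := {k | ∃ N, S N ∧ N.card = k}
  have hT : T.Nonempty := ⟨0, ∅, ⟨by simp, by simp⟩, rfl⟩
  have hTb : BddAbove T := ⟨5 ^ finrank ℝ E, by rintro _ ⟨N, hN, rfl⟩; exact hcard N hN⟩
  obtain ⟨N, hN, hNk⟩ := Nat.sSup_mem hT hTb
  refine ⟨N, hcard N hN, hN.1, fun v hv => ?_⟩
  by_contra! hcon
  have hvN : v ∉ N := fun h => by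
    have := hcon v h
    simp at this
    linarith
  have hins : S (insert v N) := by
    refine ⟨fun c hc => ?_, fun c hc d hd hcd => ?_⟩
    · rcases Finset.mem_insert.1 hc with rfl | hc
      · exact hv
      · exact hN.1 c hc
    · rcases Finset.mem_insert.1 hc with rfl | hc <;> rcases Finset.mem_insert.1 hd with rfl | hd
      · exact absurd rfl hcd
      · exact (hcon d hd).le
      · rw [norm_sub_rev]
        exact (hcon c (by assumption)).le
      · exact hN.2 c hc d hd hcd
  have h1 := le_csSup hTb ⟨insert v N, hins, rfl⟩
  rw [Finset.card_insert_of_notMem hvN, ← hNk] at h1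
  omega

lemma norm_le_of_forall_net_inner_le {E : Type*} [NormedAddCommGroup E] [InnerProductSpace ℝ E]
    {N : Finset E} (hN : ∀ v : E, ‖v‖ ≤ 2 → ∃ c ∈ N, ‖v - c‖ ≤ 1) {u : E} {t : ℝ} (ht : 0 ≤ t)
    (h : ∀ d ∈ N, inner ℝ d u ≤ t) : ‖u‖ ≤ t := by
  rcases eq_or_ne u 0 with rfl | hu
  · simpa using ht
  have hu' : 0 < ‖u‖ := norm_pos_iff.2 hu
  obtain ⟨d, hd, hvd⟩ := hN ((2 / ‖u‖) • u) (by
    rw [norm_smul, Real.norm_of_nonneg (by positivity), div_mul_cancel₀ _ hu'.ne'])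
  have h1 : inner ℝ ((2 / ‖u‖) • u) u = 2 * ‖u‖ := by
    rw [real_inner_smul_left, real_inner_self_eq_norm_sq]
    field_simp
  have h2 : inner ℝ ((2 / ‖u‖) • u - d) u ≤ 1 * ‖u‖ :=
    (real_inner_le_norm _ _).trans (by gcongr)
  rw [inner_sub_left, h1] at h2
  linarith [h d hd]

lemma opNorm_le_of_forall_net_norm_le {E F : Type*} [NormedAddCommGroup E] [NormedSpace ℝ E]
    [NormedAddCommGroup F] [NormedSpace ℝ F] {N : Finset E}
    (hN : ∀ v : E, ‖v‖ ≤ 2 → ∃ c ∈ N, ‖v - c‖ ≤ 1) {L : E →L[ℝ] F} {t : ℝ} (ht : 0 ≤ t)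
    (h : ∀ c ∈ N, ‖L c‖ ≤ t) : ‖L‖ ≤ t := by
  have h1 : ‖L‖ ≤ (t + ‖L‖) / 2 := by
    refine ContinuousLinearMap.opNorm_le_of_unit_norm (by positivity) fun w hw => ?_
    obtain ⟨c, hc, hwc⟩ := hN ((2 : ℝ) • w) (by rw [norm_smul, hw]; norm_num)
    have h2 : ‖L ((2 : ℝ) • w - c)‖ ≤ ‖L‖ * 1 := (L.le_opNorm _).trans (by gcongr)
    have h3 : L ((2 : ℝ) • w) = L c + L ((2 : ℝ) • w - c) := by rw [← map_add]; congr 1; abel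
    have h4 : ‖L ((2 : ℝ) • w)‖ = 2 * ‖L w‖ := by
      rw [map_smul, norm_smul, Real.norm_of_nonneg (by norm_num)]
    have h5 := norm_add_le (L c) (L ((2 : ℝ) • w - c))
    rw [← h3, h4] at h5
    linarith [h c hc]
  linarith

lemma vnorm_eq_norm_toLp {ι : Type*} [Fintype ι] (v : ι → ℝ) : vnorm v = ‖WithLp.toLp 2 v‖ := by
  simp [vnorm, EuclideanSpace.norm_eq]

lemma spec_le_of_forall_net_le {ι κ : Type*} [Fintype ι] [Fintype κ]
    {N : Finset (EuclideanSpace ℝ ι)} {N' : Finset (EuclideanSpace ℝ κ)}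
    (hN : ∀ v : EuclideanSpace ℝ ι, ‖v‖ ≤ 2 → ∃ c ∈ N, ‖v - c‖ ≤ 1)
    (hN' : ∀ v : EuclideanSpace ℝ κ, ‖v‖ ≤ 2 → ∃ c ∈ N', ‖v - c‖ ≤ 1)
    {M : Matrix ι κ ℝ} {t : ℝ} (ht : 0 ≤ t)
    (h : ∀ d ∈ N, ∀ c ∈ N', d.ofLp ⬝ᵥ M.mulVec c.ofLp ≤ t) : spec M ≤ t := by
  classical
  let L : EuclideanSpace ℝ κ →L[ℝ] EuclideanSpace ℝ ι :=
    LinearMap.toContinuousLinearMap (Matrix.toEuclideanLin M)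
  have hL : ∀ c, L c = WithLp.toLp 2 (M.mulVec c.ofLp) := fun c => rfl
  have hLt : ‖L‖ ≤ t := by
    refine opNorm_le_of_forall_net_norm_le hN' ht fun c hc =>
      norm_le_of_forall_net_inner_le hN ht fun d hd => ?_
    have : inner ℝ d (L c) = d.ofLp ⬝ᵥ M.mulVec c.ofLp := by
      rw [hL, EuclideanSpace.inner_eq_star_dotProduct, dotProduct_comm]
      simp
    rw [this]
    exact h d hd c hc
  refine Real.sSup_le ?_ ht
  rintro _ ⟨z, hz, rfl⟩
  rw [vnorm_eq_norm_toLp] at hz ⊢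
  have h1 := L.le_opNorm (WithLp.toLp 2 z)
  rw [hz, hL, mul_one] at h1
  exact h1.trans hLt

lemma spec_zero {ι κ : Type*} [Fintype ι] [Fintype κ] : spec (0 : Matrix ι κ ℝ) = 0 := by
  refine le_antisymm (Real.sSup_le ?_ le_rfl) (Real.sSup_nonneg ?_) <;>
  · rintro _ ⟨z, -, rfl⟩
    simp [vnorm]

end Net

section Concentration

variable {n q m : ℕ}

lemma dotProduct_initMat_sub_mulVec (hm : m ≠ 0) (X : Matrix (Fin n) (Fin q) ℝ) (α : ℝ)
    (d : Fin n → ℝ) (c : Fin q → ℝ) (ω : Fin q → Fin m → Fin n → ℝ) :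
    d ⬝ᵥ (initMat (fun k => matCol X k) α ω -
        X * Matrix.diagonal (fun k => betaK (vnorm (matCol X k)) α)).mulVec c =
      ∑ k, ∑ i, c k / m * (truncProd d (matCol X k) α (ω k i) -
        (d ⬝ᵥ matCol X k) * betaK (vnorm (matCol X k)) α) := by
  have hm' : (m : ℝ) ≠ 0 := by exact_mod_cast hm
  have hcol : ∀ k, ∑ i, c k / m * (truncProd d (matCol X k) α (ω k i) -
        (d ⬝ᵥ matCol X k) * betaK (vnorm (matCol X k)) α) =
      c k * ∑ j, d j * (initMat (fun k => matCol X k) α ω j k -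
        X j k * betaK (vnorm (matCol X k)) α) := by
    intro k
    rw [← Finset.mul_sum, Finset.sum_sub_distrib, Finset.sum_const, Finset.card_univ,
      Fintype.card_fin, nsmul_eq_mul]
    have h1 : ∑ j, d j * initMat (fun k => matCol X k) α ω j k =
        1 / m * ∑ i, truncProd d (matCol X k) α (ω k i) := by
      simp only [initMat, Matrix.of_apply, Finset.mul_sum]
      rw [Finset.sum_comm]
      refine Finset.sum_congr rfl fun i _ => ?_
      rw [truncProd]
      conv_rhs => rw [dotProduct, Finset.sum_mul, Finset.mul_sum]
      exact Finset.sum_congr rfl fun j _ => by ring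
    have h2 : ∑ j, d j * (X j k * betaK (vnorm (matCol X k)) α) =
        (d ⬝ᵥ matCol X k) * betaK (vnorm (matCol X k)) α := by
      rw [dotProduct, Finset.sum_mul]
      exact Finset.sum_congr rfl fun j _ => by rw [matCol]; ring
    simp_rw [mul_sub]
    rw [Finset.sum_sub_distrib, h1, h2]
    field_simp
  simp_rw [hcol]
  simp only [dotProduct, Matrix.mulVec, Matrix.sub_apply, Matrix.mul_diagonal, Finset.mul_sum]
  rw [Finset.sum_comm]
  exact Finset.sum_congr rfl fun k _ => Finset.sum_congr rfl fun j _ => by ring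

lemma measureReal_dotProduct_initMat_ge_le (hm : m ≠ 0) (X : Matrix (Fin n) (Fin q) ℝ) {α : ℝ}
    (hα : 0 < α) {d : Fin n → ℝ} (hd : d ⬝ᵥ d ≤ 4) {c : Fin q → ℝ} (hc : c ⬝ᵥ c ≤ 4)
    {t : ℝ} (ht : 0 ≤ t) :
    (gaussianMatrices q m n).real {ω | t ≤ d ⬝ᵥ (initMat (fun k => matCol X k) α ω -
        X * Matrix.diagonal (fun k => betaK (vnorm (matCol X k)) α)).mulVec c} ≤
      Real.exp (-(t ^ 2 * m / (512 * α))) := by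
  have hm' : (0 : ℝ) < m := by exact_mod_cast Nat.pos_of_ne_zero hm
  simp_rw [dotProduct_initMat_sub_mulVec hm]
  obtain ⟨v, hv⟩ : ∃ v : ℝ≥0, (v : ℝ) = α * 4 := ⟨_, Real.coe_toNNReal _ (by positivity)⟩
  obtain ⟨w, hw⟩ : ∃ w : ℝ≥0, (w : ℝ) = 256 * α / m := ⟨_, Real.coe_toNNReal _ (by positivity)⟩
  have hex : ∀ k, ∃ u : ℝ≥0, (u : ℝ) = (c k / m) ^ 2 * (16 * (α * 4)) := fun k =>
    ⟨_, Real.coe_toNNReal _ (by positivity)⟩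
  choose u hu using hex
  have hsub := fun k (_ : Fin m) => ((hasSubgaussianMGF_truncProd d (matCol X k) hα.le
    (v := v) (by rw [hv]; gcongr)).const_mul (c k / m)).mono (c' := u k) (by
      rw [← NNReal.coe_le_coe, hu, ← hv]
      exact le_rfl)
  have hsum := hasSubgaussianMGF_sum_pi fun k => hasSubgaussianMGF_sum_pi (hsub k)
  have hmono := hsum.mono (c' := w) (by
    rw [← NNReal.coe_le_coe, hw]
    push_cast
    simp only [hu, Finset.sum_const, Finset.card_univ, Fintype.card_fin, nsmul_eq_mul]
    have : ∑ k, (m : ℝ) * ((c k / m) ^ 2 * (16 * (α * 4))) = 64 * α / m * (c ⬝ᵥ c) := by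
      rw [dotProduct, Finset.mul_sum]
      refine Finset.sum_congr rfl fun k _ => ?_
      field_simp
      ring
    calc _ = 64 * α / m * (c ⬝ᵥ c) := this
      _ ≤ 64 * α / m * 4 := by gcongr
      _ = 256 * α / m := by ring)
  refine (hmono.measure_ge_le ht).trans_eq ?_
  rw [hw]
  congr 1
  field_simp
  ring

lemma gaussianMatrices_spec_initMat_le (hm : m ≠ 0) (X : Matrix (Fin n) (Fin q) ℝ) {α : ℝ}
    (hα : 0 < α) {t : ℝ} (ht : 0 ≤ t) :
    1 - 5 ^ (n + q) * Real.exp (-(t ^ 2 * m / (512 * α))) ≤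
      (gaussianMatrices q m n).real {ω | spec (initMat (fun k => matCol X k) α ω -
        X * Matrix.diagonal (fun k => betaK (vnorm (matCol X k)) α)) ≤ t} := by
  obtain ⟨N, hNc, hNb, hN⟩ := exists_finset_net_closedBall_two (EuclideanSpace ℝ (Fin n))
  obtain ⟨N', hNc', hNb', hN'⟩ := exists_finset_net_closedBall_two (EuclideanSpace ℝ (Fin q))
  rw [finrank_euclideanSpace_fin] at hNc hNc'
  have hself : ∀ {l : ℕ} (v : EuclideanSpace ℝ (Fin l)), ‖v‖ ≤ 2 → v.ofLp ⬝ᵥ v.ofLp ≤ 4 := by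
    intro l v hv
    have h : vnorm v.ofLp = ‖v‖ := vnorm_eq_norm_toLp _
    rw [dotProduct_self_eq_vnorm_sq, h]
    nlinarith [norm_nonneg v]
  set P := gaussianMatrices q m n
  set M := fun ω => initMat (fun k => matCol X k) α ω -
        X * Matrix.diagonal (fun k => betaK (vnorm (matCol X k)) α)
  set G := {ω | spec (M ω) ≤ t}
  let B := fun p : EuclideanSpace ℝ (Fin n) × EuclideanSpace ℝ (Fin q) =>
    {ω | t ≤ p.1.ofLp ⬝ᵥ (M ω).mulVec p.2.ofLp}
  have hcover : Set.univ ⊆ G ∪ ⋃ p ∈ N ×ˢ N', B p := by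
    intro ω _
    by_contra hω
    rw [Set.mem_union, not_or] at hω
    refine hω.1 (spec_le_of_forall_net_le hN hN' ht fun d hd c hc => ?_)
    by_contra! hlt
    exact hω.2 (Set.mem_biUnion (Finset.mem_coe.2 (Finset.mk_mem_product hd hc)) hlt.le)
  have hB : P.real (⋃ p ∈ N ×ˢ N', B p) ≤
      5 ^ (n + q) * Real.exp (-(t ^ 2 * m / (512 * α))) := by
    refine (measureReal_biUnion_finset_le _ _).trans ?_
    calc _ ≤ ∑ _p ∈ N ×ˢ N', Real.exp (-(t ^ 2 * m / (512 * α))) := by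
          refine Finset.sum_le_sum fun p hp => ?_
          rw [Finset.mem_product] at hp
          exact measureReal_dotProduct_initMat_ge_le hm X hα (hself _ (hNb _ hp.1))
            (hself _ (hNb' _ hp.2)) ht
      _ ≤ _ := by
          rw [Finset.sum_const, nsmul_eq_mul, Finset.card_product, pow_add]
          push_cast
          gcongr
          · exact_mod_cast hNc
          · exact_mod_cast hNc'
  have h1 : (1 : ℝ) ≤ P.real G + P.real (⋃ p ∈ N ×ˢ N', B p) := by
    calc (1 : ℝ) = P.real Set.univ := by simp
      _ ≤ P.real (G ∪ ⋃ p ∈ N ×ˢ N', B p) := measureReal_mono hcover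
      _ ≤ _ := measureReal_union_le _ _
  linarith

end Concentration
/-- **Lemma 3.8, part 1** (spectral-norm concentration of the truncated initialization,
fixed threshold). -/
theorem lemma38_part1 :
    ∃ c : ℝ, 0 < c ∧
    ∀ (n q r m : ℕ) (Ustar : Matrix (Fin n) (Fin r) ℝ) (Btil : Matrix (Fin r) (Fin q) ℝ)
      (μ ε₁ σp σm κ α : ℝ),
      Ustarᵀ * Ustar = 1 → Btil.rank = r →
      σp = spec (Ustar * Btil) → σm = sigMin Btil → κ = σp / σm →
      1 ≤ μ → (∀ k, vnorm (matCol Btil k) ≤ μ * σp * Real.sqrt ((r : ℝ) / q)) →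
      0 < ε₁ → ε₁ < 1 →
      9 * κ ^ 2 * μ ^ 2 * (1 - ε₁) * frob (Ustar * Btil) ^ 2 / q ≤ α →
      α ≤ 9 * κ ^ 2 * μ ^ 2 * (1 + ε₁) * frob (Ustar * Btil) ^ 2 / q →
      ENNReal.ofReal (1 - Real.exp (((n : ℝ) + q) - c * ε₁ ^ 2 * m * q / (μ ^ 2 * κ ^ 2))) ≤
        gaussianMatrices q m n {ω |
          spec (initMat (fun k => matCol (Ustar * Btil) k) α ω -
              (Ustar * Btil) * Matrix.diagonal (fun k =>
                betaK (vnorm (matCol (Ustar * Btil) k)) α)) ≤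
            1.1 * ε₁ * frob (Ustar * Btil)} := by
  refine ⟨1 / 20000, by norm_num, ?_⟩
  intro n q r m U B μ ε σp σm κ α _ _ hσp _ hκ _ _ hε hε1 hαl hαu
  set X := U * B with hX
  set T : ℝ := ε ^ 2 * m * q / (μ ^ 2 * κ ^ 2) with hT
  have hTc : 1 / 20000 * ε ^ 2 * m * q / (μ ^ 2 * κ ^ 2) = 1 / 20000 * T := by rw [hT]; ring
  rw [hTc]
  rcases le_or_gt (1 / 20000 * T) ((n : ℝ) + q) with htriv | hlt
  · rw [ENNReal.ofReal_of_nonpos]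
    · exact zero_le
    · linarith [Real.one_le_exp (sub_nonneg.2 htriv)]
  have hT0 : 0 < T := by
    have : (0 : ℝ) ≤ (n : ℝ) + q := by positivity
    linarith
  have hm : m ≠ 0 := by rintro rfl; simp [hT] at hT0
  have hq : q ≠ 0 := by rintro rfl; simp [hT] at hT0
  have hμ0 : μ ≠ 0 := by rintro rfl; simp [hT] at hT0
  have hκ0 : κ ≠ 0 := by rintro rfl; simp [hT] at hT0
  have hF : 0 < frob X := by
    refine (Real.sqrt_nonneg _).lt_of_ne fun h => hκ0 ?_
    have hX0 : X = 0 := by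
      ext i j
      have h0 := (Real.sqrt_eq_zero (by positivity)).1 h.symm
      rw [Finset.sum_eq_zero_iff_of_nonneg fun _ _ => by positivity] at h0
      have h1 := h0 i (Finset.mem_univ i)
      rw [Finset.sum_eq_zero_iff_of_nonneg fun _ _ => by positivity] at h1
      simpa using h1 j (Finset.mem_univ j)
    rw [hκ, hσp, hX0, spec_zero, zero_div]
  set F := frob X
  have hm' : (0 : ℝ) < m := by exact_mod_cast Nat.pos_of_ne_zero hm
  have hq' : (0 : ℝ) < q := by exact_mod_cast Nat.pos_of_ne_zero hq
  have hα : 0 < α := by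
    have : 0 < 1 - ε := by linarith
    exact lt_of_lt_of_le (by positivity) hαl
  have hαu' : α ≤ 18 * κ ^ 2 * μ ^ 2 * F ^ 2 / q := by
    refine hαu.trans ?_
    rw [show 18 * κ ^ 2 * μ ^ 2 * F ^ 2 = 9 * κ ^ 2 * μ ^ 2 * 2 * F ^ 2 by ring]
    gcongr
    linarith
  have hexpo : 1 / 10000 * T ≤ (1.1 * ε * F) ^ 2 * m / (512 * α) := by
    calc 1 / 10000 * T ≤ (1.1 * ε * F) ^ 2 * m / (512 * (18 * κ ^ 2 * μ ^ 2 * F ^ 2 / q)) := by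
          have : (1.1 * ε * F) ^ 2 * m / (512 * (18 * κ ^ 2 * μ ^ 2 * F ^ 2 / q)) =
              1.21 / 9216 * T := by
            rw [hT]
            field_simp
            norm_num
          rw [this]
          exact mul_le_mul_of_nonneg_right (by norm_num) hT0.le
      _ ≤ _ := by gcongr
  have hmain := gaussianMatrices_spec_initMat_le hm X hα (t := 1.1 * ε * F) (by positivity)
  have h5 : (5 : ℝ) ^ (n + q) ≤ Real.exp (2 * ((n : ℝ) + q)) := by
    have h : (5 : ℝ) ≤ Real.exp 2 := by
      have := Real.quadratic_le_exp_of_nonneg (x := 2) (by norm_num)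
      linarith
    calc (5 : ℝ) ^ (n + q) ≤ Real.exp 2 ^ (n + q) := by gcongr
      _ = _ := by rw [← Real.exp_nat_mul]; push_cast; ring_nf
  have hfin : 5 ^ (n + q) * Real.exp (-((1.1 * ε * F) ^ 2 * m / (512 * α))) ≤
      Real.exp ((n : ℝ) + q - 1 / 20000 * T) := by
    calc _ ≤ Real.exp (2 * ((n : ℝ) + q)) * Real.exp (-((1.1 * ε * F) ^ 2 * m / (512 * α))) := by
          gcongr
      _ ≤ _ := by
          rw [← Real.exp_add]
          gcongr
          linarith
  rw [← ofReal_measureReal]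
  exact ENNReal.ofReal_le_ofReal (le_trans (by linarith) hmain)
end
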